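/- arXiv:1306.5469 — 2 statements merged into one kernel-verified Lean document; each statement's English description precedes it below -/
import Mathlib

section
/- Let 𝒥 ⊆ ℝ² be a self-similar set satisfying the Open Set Condition with dim_H(𝒥) = 1, and assume 𝒥 is not contained in a line. Then there exist constants κ > 0, C₀ > 0 and K ≥ 1, depending only on 𝒥 and not on δ, such that for every 0 < δ ≤ 1 the closed δ-neighborhood 𝒥^δ is equivalent to a (κ,C₀,δ)-unrectifiable one-set: there exist (κ,C₁,δ₁)- and (κ,C₂,δ₂)-unrectifiable one-sets 𝒜₁, 𝒜₂ with 𝒜₁ ⊆ 𝒥^δ ⊆ 𝒜₂, C_i ≤ K·C₀, and K^{−1}δ ≤ δ_i ≤ Kδ for i = 1,2. -/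
open MeasureTheory Metric Set

/-- A line in the plane. -/
def IsLine (ℓ : Set ℂ) : Prop := ∃ p v : ℂ, v ≠ 0 ∧ ℓ = {w : ℂ | ∃ t : ℝ, w = p + t • v}

/-- An `(α, C, δ)`-set that is unconcentrated on lines. -/
def UnconcSet (α C δ : ℝ) (A : Set ℂ) : Prop :=
  (∃ P : Set ℂ, P.Nonempty ∧ A = (⋃ x ∈ P, closedBall x δ) ∧
      ∀ y : ℂ, {x ∈ P | y ∈ closedBall x δ}.Finite ∧
        (({x ∈ P | y ∈ closedBall x δ}).ncard : ℝ) ≤ C) ∧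
  C⁻¹ * δ ^ (2 - α) ≤ (volume A).toReal ∧
  (volume A).toReal ≤ C * δ ^ (2 - α) ∧
  (∀ (x : ℂ) (r : ℝ), 0 < r →
      (volume (A ∩ closedBall x r)).toReal ≤ C * r ^ α * (volume A).toReal) ∧
  (∀ ℓ : Set ℂ, IsLine ℓ →
      (volume (A ∩ cthickening C⁻¹ ℓ)).toReal ≤ (volume A).toReal / 10)

/-- A rectangle with side lengths `r₂` (long side) and `r₁` (short side). -/
def IsRect (R : Set ℂ) (r₁ r₂ : ℝ) : Prop :=
  ∃ z w : ℂ, ‖w‖ = 1 ∧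
    R = (fun p : ℝ × ℝ => z + p.1 • w + p.2 • (w * Complex.I)) '' (Icc 0 r₂ ×ˢ Icc 0 r₁)

/-- A `(κ, C, δ)`-unrectifiable one-set. -/
def UnrectOneSet (κ C δ : ℝ) (A : Set ℂ) : Prop :=
  UnconcSet 1 C δ A ∧
  ∀ (R : Set ℂ) (r₁ r₂ : ℝ), 0 < r₁ → r₁ ≤ r₂ → IsRect R r₁ r₂ →
    (volume (A ∩ R)).toReal ≤ C * r₁ ^ κ * r₂ ^ (1 - κ) * (volume A).toReal

namespace SS

def cns {s : ℕ} (i : Fin s) (w : ℕ → Fin s) : ℕ → Fin s := fun n => Nat.casesOn n i w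

lemma cns_measurable {s : ℕ} (i : Fin s) : Measurable (cns i) := by
  refine measurable_pi_lambda _ fun n => ?_
  cases n with
  | zero => exact measurable_const
  | succ n => exact measurable_pi_apply n

lemma prod_self {s : ℕ} (ρ : Measure (Fin s)) [IsProbabilityMeasure ρ] :
    (∑ i, ρ {i} • (Measure.infinitePi (fun _ : ℕ => ρ)).map (cns i))
      = Measure.infinitePi (fun _ : ℕ => ρ) := by
  classical
  refine Measure.eq_infinitePi _ fun S t ht => ?_
  obtain ⟨N, hN⟩ := S.exists_nat_subset_range
  set t' : ℕ → Set (Fin s) := fun n => if n ∈ S then t n else univ with ht'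
  have h1 : (S : Set ℕ).pi t = ((Finset.range (N+1) : Finset ℕ) : Set ℕ).pi t' := by
    ext x
    simp only [Set.mem_pi, Finset.mem_coe, ht']
    constructor
    · intro h n _
      by_cases hn : n ∈ S
      · simpa [hn] using h n hn
      · simp [hn]
    · intro h n hn
      have := h n (Finset.mem_range.2 (Nat.lt_succ_of_lt (Finset.mem_range.1 (hN hn))))
      simpa [hn] using this
  have h2 : ∏ i ∈ S, ρ (t i) = ∏ i ∈ Finset.range (N+1), ρ (t' i) := by
    have hS : S ⊆ Finset.range (N+1) := fun n hn =>
      Finset.mem_range.2 (Nat.lt_succ_of_lt (Finset.mem_range.1 (hN hn)))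
    rw [← Finset.prod_subset hS]
    · exact Finset.prod_congr rfl fun i hi => by simp [ht', hi]
    · intro i _ hi
      simp [ht', hi]
  rw [h2, h1, Measure.finsetSum_apply, Finset.prod_range_succ']
  have h3 : ∀ i, (Measure.infinitePi (fun _ : ℕ => ρ)).map (cns i)
      (((Finset.range (N+1) : Finset ℕ) : Set ℕ).pi t') =
      if i ∈ t' 0 then ∏ n ∈ Finset.range N, ρ (t' (n+1)) else 0 := by
    intro i
    rw [Measure.map_apply (cns_measurable i)
      (MeasurableSet.pi (Finset.countable_toSet _) fun _ _ => MeasurableSet.of_discrete)]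
    split_ifs with hi
    · rw [← Measure.infinitePi_pi (μ := fun _ : ℕ => ρ) (s := Finset.range N)
        (t := fun n => t' (n+1)) (fun _ _ => MeasurableSet.of_discrete)]
      congr 1
      ext x
      simp only [mem_preimage, Set.mem_pi, Finset.mem_coe, Finset.mem_range]
      constructor
      · intro h n hn
        exact h (n+1) (by omega)
      · intro h n hn
        cases n with
        | zero => exact hi
        | succ n => exact h n (by omega)
    · convert measure_empty (μ := Measure.infinitePi (fun _ : ℕ => ρ))
      ext x
      simp only [mem_preimage, Set.mem_pi, Finset.mem_coe, Finset.mem_range, mem_empty_iff_false,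
        iff_false]
      intro h
      exact hi (h 0 (by omega))
  simp only [Measure.smul_apply, h3, smul_eq_mul]
  have h4 : ρ (t' 0) = ∑ i, if i ∈ t' 0 then ρ {i} else 0 := by
    rw [← Finset.sum_filter]
    rw [sum_measure_singleton]
    congr 1
    ext; simp
  rw [h4, Finset.mul_sum]
  refine Finset.sum_congr rfl fun i _ => ?_
  split_ifs <;> simp [mul_comm]

def cod {s : ℕ} (T : Fin s → ℂ → ℂ) (x0 : ℂ) : ℕ → (ℕ → Fin s) → ℂ
  | 0, _ => x0
  | n+1, w => T (w 0) (cod T x0 n (fun k => w (k+1)))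

lemma exists_measure {s : ℕ} (T : Fin s → ℂ → ℂ) (lam : Fin s → ℝ) (L : ℝ) (hL : L < 1)
    (hL0 : 0 ≤ L)
    (hlam : ∀ i, lam i ≤ L) (hTd : ∀ i x y, dist (T i x) (T i y) = lam i * dist x y)
    (J : Set ℂ) (hJc : IsCompact J) (hJne : J.Nonempty) (hJ : ∀ i, T i '' J ⊆ J)
    (p : Fin s → ℝ) (hp : ∀ i, 0 ≤ p i) (hp1 : ∑ i, p i = 1) :
    ∃ μ : Measure ℂ, IsProbabilityMeasure μ ∧ μ Jᶜ = 0 ∧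
      ∀ A, MeasurableSet A → μ.real A = ∑ i, p i * μ.real (T i ⁻¹' A) := by
  classical
  obtain ⟨x0, hx0⟩ := hJne
  have hTc : ∀ i, Continuous (T i) := fun i => by
    refine (LipschitzWith.of_dist_le_mul (K := Real.toNNReal L) fun x y => ?_).continuous
    rw [hTd, Real.coe_toNNReal _ hL0]
    exact mul_le_mul_of_nonneg_right (hlam i) dist_nonneg
  set ρ : Measure (Fin s) := ∑ i, ENNReal.ofReal (p i) • Measure.dirac i with hρ
  have hρi : ∀ i, ρ {i} = ENNReal.ofReal (p i) := by
    intro i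
    rw [hρ, Measure.finsetSum_apply]
    simp [Set.indicator_apply, Finset.sum_ite_eq]
  have hρp : IsProbabilityMeasure ρ := ⟨by
    rw [hρ, Measure.finsetSum_apply]
    simp only [Measure.smul_apply, measure_univ, smul_eq_mul, mul_one]
    rw [← ENNReal.ofReal_sum_of_nonneg (fun i _ => hp i), hp1, ENNReal.ofReal_one]⟩
  set P := Measure.infinitePi (fun _ : ℕ => ρ) with hP
  have hcm : ∀ n, Measurable (cod T x0 n) := by
    intro n
    induction n with
    | zero => exact measurable_const
    | succ n ih =>
      have h : Measurable (fun q : Fin s × ℂ => T q.1 q.2) :=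
        measurable_from_prod_countable_right (fun i => (hTc i).measurable)
      have h2 : Measurable (fun w : ℕ → Fin s => (w 0, cod T x0 n (fun k => w (k+1)))) :=
        (measurable_pi_apply 0).prodMk (ih.comp (measurable_pi_lambda _ fun k =>
          measurable_pi_apply (k+1)))
      exact h.comp h2
  have hcJ : ∀ n w, cod T x0 n w ∈ J := by
    intro n
    induction n with
    | zero => intro w; exact hx0
    | succ n ih => intro w; exact hJ _ (mem_image_of_mem _ (ih _))
  have hcd : ∀ n w, dist (cod T x0 n w) (cod T x0 (n+1) w) ≤ diam J * L ^ n := by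
    intro n
    induction n with
    | zero =>
      intro w
      simpa using dist_le_diam_of_mem hJc.isBounded (hcJ 0 w) (hcJ 1 w)
    | succ n ih =>
      intro w
      change dist (T _ _) (T _ _) ≤ _
      rw [hTd, pow_succ]
      calc _ ≤ L * (diam J * L ^ n) :=
            mul_le_mul (hlam _) (ih _) dist_nonneg hL0
        _ = _ := by ring
  have hcs : ∀ w, ∃ y, Filter.Tendsto (fun n => cod T x0 n w) Filter.atTop (nhds y) := fun w =>
    cauchySeq_tendsto_of_complete (cauchySeq_of_le_geometric L _ hL (fun n => hcd n w))
  choose π hπ using hcs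
  have hπm : Measurable π := measurable_of_tendsto_metrizable hcm (tendsto_pi_nhds.2 hπ)
  have hπJ : ∀ w, π w ∈ J := fun w =>
    hJc.isClosed.mem_of_tendsto (hπ w) (Filter.Eventually.of_forall fun n => hcJ n w)
  have hπc : ∀ i w, π (cns i w) = T i (π w) := by
    intro i w
    refine tendsto_nhds_unique ((Filter.tendsto_add_atTop_iff_nat 1).2 (hπ (cns i w))) ?_
    exact ((hTc i).tendsto _).comp (hπ w)
  have hPself : ∀ B, MeasurableSet B → P B = ∑ i, ENNReal.ofReal (p i) * P (cns i ⁻¹' B) := by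
    intro B hB
    conv_lhs => rw [hP, ← prod_self ρ]
    rw [Measure.finsetSum_apply]
    refine Finset.sum_congr rfl fun i _ => ?_
    rw [Measure.smul_apply, hρi, Measure.map_apply (cns_measurable i) hB, smul_eq_mul]
  refine ⟨P.map π, Measure.isProbabilityMeasure_map hπm.aemeasurable, ?_, ?_⟩
  · rw [Measure.map_apply hπm hJc.isClosed.measurableSet.compl]
    convert measure_empty (μ := P)
    ext w; simp [hπJ w]
  · intro A hA
    have : IsProbabilityMeasure (P.map π) := Measure.isProbabilityMeasure_map hπm.aemeasurable
    have h : (P.map π) A = ∑ i, ENNReal.ofReal (p i) * (P.map π) (T i ⁻¹' A) := by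
      rw [Measure.map_apply hπm hA, hPself _ (hπm hA)]
      refine Finset.sum_congr rfl fun i _ => ?_
      rw [Measure.map_apply hπm ((hTc i).measurable hA)]
      congr 2
      ext w
      simp [hπc]
    rw [Measure.real, h, ENNReal.toReal_sum (fun i _ => by finiteness)]
    refine Finset.sum_congr rfl fun i _ => ?_
    rw [ENNReal.toReal_mul, ENNReal.toReal_ofReal (hp i), Measure.real]

end SS

namespace SS

def wT {s : ℕ} (T : Fin s → ℂ → ℂ) : List (Fin s) → ℂ → ℂ
  | [] => id
  | i :: w => T i ∘ wT T w

def wp {s : ℕ} (g : Fin s → ℝ) : List (Fin s) → ℝ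
  | [] => 1
  | i :: w => g i * wp g w

structure Sys {s : ℕ} (T : Fin s → ℂ → ℂ) (lam : Fin s → ℝ)
    (rot : Fin s → ℂ ≃ₗᵢ[ℝ] ℂ) (z : Fin s → ℂ) (J Op : Set ℂ) (p : Fin s → ℝ)
    (μ : Measure ℂ) (l L : ℝ) : Prop where
  l0 : 0 < l
  l1 : l ≤ 1
  hl : ∀ i, l ≤ lam i
  hL : ∀ i, lam i ≤ L
  L1 : L < 1
  L0 : 0 < L
  hT : ∀ i x, T i x = lam i • (rot i x) + z i
  Jc : IsCompact J
  Jne : J.Nonempty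
  self : J = ⋃ i, T i '' J
  Oo : IsOpen Op
  One : Op.Nonempty
  Osub : ∀ i, T i '' Op ⊆ Op
  Od : ∀ i j, i ≠ j → Disjoint (T i '' Op) (T j '' Op)
  hp : ∀ i, 0 < p i
  prob : IsProbabilityMeasure μ
  μJ : μ Jᶜ = 0
  μs : ∀ A, MeasurableSet A → μ.real A = ∑ i, p i * μ.real (T i ⁻¹' A)

structure Cut {s : ℕ} (T : Fin s → ℂ → ℂ) (lam : Fin s → ℝ) (J Op : Set ℂ) (p : Fin s → ℝ)
    (μ : Measure ℂ) (a b : ℝ) (ι : Type) [Fintype ι] (f : ι → List (Fin s)) : Prop where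
  lo : ∀ k, a ≤ wp lam (f k)
  hi : ∀ k, wp lam (f k) ≤ b
  dec : ∀ A, MeasurableSet A → μ.real A = ∑ k, wp p (f k) * μ.real (wT T (f k) ⁻¹' A)
  disj : ∀ k k', k ≠ k' → Disjoint (wT T (f k) '' Op) (wT T (f k') '' Op)
  cov : J ⊆ ⋃ k, wT T (f k) '' J

section
variable {s : ℕ} {T : Fin s → ℂ → ℂ} {lam : Fin s → ℝ}
    {rot : Fin s → ℂ ≃ₗᵢ[ℝ] ℂ} {z : Fin s → ℂ} {J Op : Set ℂ} {p : Fin s → ℝ}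
    {μ : Measure ℂ} {l L : ℝ}

lemma wp_pos {g : Fin s → ℝ} (hg : ∀ i, 0 < g i) (w : List (Fin s)) : 0 < wp g w := by
  induction w with
  | nil => exact one_pos
  | cons i w ih => exact mul_pos (hg i) ih

lemma Sys.lpos (S : Sys T lam rot z J Op p μ l L) (i : Fin s) : 0 < lam i := S.l0.trans_le (S.hl i)

lemma Sys.dist (S : Sys T lam rot z J Op p μ l L) (i : Fin s) (x y : ℂ) :
    dist (T i x) (T i y) = lam i * dist x y := by
  rw [S.hT, S.hT, dist_add_right, dist_smul₀, (rot i).dist_map, Real.norm_of_nonneg (S.lpos i).le]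

lemma Sys.wdist (S : Sys T lam rot z J Op p μ l L) (w : List (Fin s)) (x y : ℂ) :
    Dist.dist (wT T w x) (wT T w y) = wp lam w * Dist.dist x y := by
  induction w with
  | nil => simp [wT, wp]
  | cons i w ih =>
    simp only [wT, wp, Function.comp]
    rw [S.dist, ih]; ring

lemma Sys.cont (S : Sys T lam rot z J Op p μ l L) (w : List (Fin s)) : Continuous (wT T w) := by
  refine (LipschitzWith.of_dist_le_mul (K := Real.toNNReal (wp lam w)) fun x y => ?_).continuous
  rw [S.wdist, Real.coe_toNNReal _ (wp_pos S.lpos w).le]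

lemma Sys.surj1 (S : Sys T lam rot z J Op p μ l L) (i : Fin s) : Function.Surjective (T i) := by
  intro y
  refine ⟨(rot i).symm ((lam i)⁻¹ • (y - z i)), ?_⟩
  rw [S.hT, LinearIsometryEquiv.apply_symm_apply, smul_smul, mul_inv_cancel₀ (S.lpos i).ne']
  simp

lemma Sys.surj (S : Sys T lam rot z J Op p μ l L) (w : List (Fin s)) :
    Function.Surjective (wT T w) := by
  induction w with
  | nil => exact Function.surjective_id
  | cons i w ih => exact (S.surj1 i).comp ih

lemma Sys.inj1 (S : Sys T lam rot z J Op p μ l L) (i : Fin s) : Function.Injective (T i) := by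
  intro x y h
  have := S.dist i x y
  rw [h, dist_self] at this
  have h2 := (mul_eq_zero.1 this.symm).resolve_left (S.lpos i).ne'
  exact dist_eq_zero.1 h2

lemma Sys.wO (S : Sys T lam rot z J Op p μ l L) (w : List (Fin s)) : wT T w '' Op ⊆ Op := by
  induction w with
  | nil => simp [wT]
  | cons i w ih =>
    rw [wT, image_comp]
    exact (image_mono ih).trans (S.Osub i)

lemma Sys.cut (S : Sys T lam rot z J Op p μ l L) (n : ℕ) : ∀ r : ℝ, L ^ n ≤ r → r ≤ 1 →
    ∃ (ι : Type) (_ : Fintype ι) (f : ι → List (Fin s)), Cut T lam J Op p μ (l * r) r ι f := by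
  have h0 : Cut T lam J Op p μ 1 1 Unit (fun _ => []) := by
    refine ⟨fun _ => le_rfl, fun _ => le_rfl, fun A _ => ?_, fun k k' h => (h rfl).elim, ?_⟩
    · simp [wp, wT]
    · intro x hx
      exact mem_iUnion.2 ⟨(), by simpa [wT] using hx⟩
  have hS : ∀ r, (∀ i, ∃ (ι : Type) (_ : Fintype ι) (f : ι → List (Fin s)),
        Cut T lam J Op p μ (l * r / lam i) (r / lam i) ι f) →
      ∃ (ι : Type) (_ : Fintype ι) (f : ι → List (Fin s)), Cut T lam J Op p μ (l * r) r ι f := by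
    intro r h
    choose ι hι f hf using h
    refine ⟨Σ i, ι i, inferInstance, fun k => k.1 :: f k.1 k.2, ?_, ?_, ?_, ?_, ?_⟩
    · rintro ⟨i, k⟩
      have := (hf i).lo k
      rw [div_le_iff₀ (S.lpos i)] at this
      simpa [wp, mul_comm] using this
    · rintro ⟨i, k⟩
      have := (hf i).hi k
      rw [le_div_iff₀ (S.lpos i)] at this
      simpa [wp, mul_comm] using this
    · intro A hA
      rw [S.μs A hA, Fintype.sum_sigma]
      refine Finset.sum_congr rfl fun i _ => ?_
      have hm : MeasurableSet (T i ⁻¹' A) := (S.cont [i]).measurable hA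
      rw [(hf i).dec _ hm, Finset.mul_sum]
      refine Finset.sum_congr rfl fun k _ => ?_
      simp only [wp, wT, preimage_comp, mul_assoc]
    · rintro ⟨i, k⟩ ⟨j, k'⟩ hne
      simp only [wT, image_comp]
      by_cases hij : i = j
      · subst hij
        have : k ≠ k' := fun h => hne (by rw [h])
        exact (disjoint_image_iff (S.inj1 i)).2 ((hf i).disj k k' this)
      · exact (S.Od i j hij).mono (image_mono (S.wO _)) (image_mono (S.wO _))
    · intro x hx
      rw [S.self] at hx
      obtain ⟨i, y, hy, rfl⟩ := mem_iUnion.1 hx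
      obtain ⟨k, u, hu, rfl⟩ := mem_iUnion.1 ((hf i).cov hy)
      exact mem_iUnion.2 ⟨⟨i, k⟩, u, hu, rfl⟩
  have hsmall : ∀ r i, lam i ≤ r → r ≤ 1 → ∃ (ι : Type) (_ : Fintype ι) (f : ι → List (Fin s)),
        Cut T lam J Op p μ (l * r / lam i) (r / lam i) ι f := by
    intro r i h h1
    refine ⟨Unit, inferInstance, fun _ => [], ⟨fun k => ?_, fun k => ?_, h0.dec, h0.disj, h0.cov⟩⟩
    · rw [div_le_iff₀ (S.lpos i)]
      simp only [wp, one_mul]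
      nlinarith [S.hl i, S.l0]
    · rw [le_div_iff₀ (S.lpos i)]
      simpa [wp] using h
  induction n with
  | zero =>
    intro r h1 h2
    exact hS r fun i => hsmall r i ((S.hL i).trans (S.L1.le.trans (by simpa using h1))) h2
  | succ n ih =>
    intro r h1 h2
    refine hS r fun i => ?_
    by_cases hi : lam i ≤ r
    · exact hsmall r i hi h2
    · rw [mul_div_assoc]
      apply ih
      · rw [le_div_iff₀ (S.lpos i)]
        calc _ ≤ L ^ n * L := by
              have := S.hL i
              have := S.L0
              gcongr
          _ ≤ r := by rw [← pow_succ]; exact h1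
      · rw [div_le_one (S.lpos i)]; exact (not_le.1 hi).le

lemma Sys.cut' (S : Sys T lam rot z J Op p μ l L) {r : ℝ} (h0 : 0 < r) (h1 : r ≤ 1) :
    ∃ (ι : Type) (_ : Fintype ι) (f : ι → List (Fin s)), Cut T lam J Op p μ (l * r) r ι f := by
  obtain ⟨n, hn⟩ := exists_pow_lt_of_lt_one h0 S.L1
  exact S.cut n r hn.le h1

/-- packing in the plane -/
lemma packing {ι : Type*} (t : Finset ι) (c : ι → ℂ) (x : ℂ) (η R : ℝ) (hη : 0 < η) (hR : 0 ≤ R)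
    (hd : ∀ k ∈ t, ∀ k' ∈ t, k ≠ k' → Disjoint (ball (c k) η) (ball (c k') η))
    (hs : ∀ k ∈ t, ball (c k) η ⊆ ball x R) : (t.card : ℝ) * η ^ 2 ≤ R ^ 2 := by
  have hv : ∀ (y : ℂ) (r : ℝ), 0 ≤ r → volume.real (ball y r) = r ^ 2 * Real.pi := by
    intro y r hr
    rw [Measure.real, Complex.volume_ball]
    simp [hr]
  have h1 : volume.real (⋃ k ∈ t, ball (c k) η) = ∑ k ∈ t, volume.real (ball (c k) η) :=
    measureReal_biUnion_finset (fun k hk k' hk' h => hd k hk k' hk' h)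
      (fun _ _ => measurableSet_ball) (fun _ _ => measure_ball_lt_top.ne)
  have h2 : volume.real (⋃ k ∈ t, ball (c k) η) ≤ volume.real (ball x R) :=
    measureReal_mono (iUnion₂_subset hs) measure_ball_lt_top.ne
  rw [h1, hv x R hR] at h2
  simp only [hv _ η hη.le, Finset.sum_const, nsmul_eq_mul] at h2
  rw [← mul_assoc] at h2
  exact le_of_mul_le_mul_right h2 Real.pi_pos

open Classical in
lemma Sys.count (S : Sys T lam rot z J Op p μ l L) : ∃ M : ℝ, 0 < M ∧
    ∀ r, 0 < r → r ≤ 1 → ∀ (ι : Type) (_ : Fintype ι) (f : ι → List (Fin s)),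
      Cut T lam J Op p μ (l * r) r ι f → ∀ x : ℂ,
      ((Finset.univ.filter fun k => (wT T (f k) '' J ∩ closedBall x r).Nonempty).card : ℝ) ≤ M := by
  obtain ⟨a, ha⟩ := S.One
  obtain ⟨ρ, hρ, hU⟩ := Metric.isOpen_iff.1 S.Oo a ha
  obtain ⟨E, hE⟩ := S.Jc.isBounded.subset_closedBall a
  have hE0 : 0 ≤ E := by
    obtain ⟨y, hy⟩ := S.Jne
    exact dist_nonneg.trans (mem_closedBall.1 (hE hy))
  have hl := S.l0
  refine ⟨(2 + E + ρ) ^ 2 / (l * ρ) ^ 2, by positivity, ?_⟩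
  intro r hr hr1 ι _ f hf x
  rw [le_div_iff₀ (by positivity)]
  have key := packing (Finset.univ.filter fun k => (wT T (f k) '' J ∩ closedBall x r).Nonempty)
    (fun k => wT T (f k) a) x (l * r * ρ) ((2 + E + ρ) * r) (by positivity) (by positivity) ?_ ?_
  · have h2 : ∀ N : ℝ, N * (l * r * ρ) ^ 2 = N * (l * ρ) ^ 2 * r ^ 2 := fun N => by ring
    rw [h2, mul_pow (2 + E + ρ) r 2] at key
    exact le_of_mul_le_mul_right key (by positivity)
  · intro k _ k' _ hne
    have hsub : ∀ k, ball (wT T (f k) a) (l * r * ρ) ⊆ wT T (f k) '' Op := by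
      intro k y hy
      obtain ⟨u, rfl⟩ := S.surj (f k) y
      refine ⟨u, hU ?_, rfl⟩
      rw [mem_ball, S.wdist] at hy
      have h1 := hf.lo k
      rw [mem_ball]
      have h3 : l * r * Dist.dist u a < l * r * ρ :=
        lt_of_le_of_lt (mul_le_mul_of_nonneg_right h1 dist_nonneg) hy
      exact lt_of_mul_lt_mul_left h3 (by positivity)
    exact (hf.disj k k' hne).mono (hsub k) (hsub k')
  · intro k hk y hy
    obtain ⟨-, u, ⟨v, hv, rfl⟩, hu⟩ := Finset.mem_filter.1 hk
    rw [mem_ball] at hy ⊢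
    rw [mem_closedBall] at hu
    have h1 : Dist.dist (wT T (f k) a) (wT T (f k) v) ≤ r * E := by
      rw [S.wdist, dist_comm a v]
      exact mul_le_mul (hf.hi k) (mem_closedBall.1 (hE hv)) dist_nonneg hr.le
    have h2 : l * r * ρ ≤ r * ρ := by
      have := S.l1
      have : l * (r * ρ) ≤ 1 * (r * ρ) := by gcongr
      linarith
    have h3 := dist_triangle y (wT T (f k) a) x
    have h4 := dist_triangle (wT T (f k) a) (wT T (f k) v) x
    linarith

open Classical in
/-- local estimate: `μ (B ∩ A)` through pieces meeting the ball. -/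
lemma Sys.local (S : Sys T lam rot z J Op p μ l L) {r M Q : ℝ}
    {ι : Type} [Fintype ι] {f : ι → List (Fin s)} {a b : ℝ}
    (hf : Cut T lam J Op p μ a b ι f) (x : ℂ) (A : Set ℂ) (hA : MeasurableSet A)
    (hM : ((Finset.univ.filter fun k => (wT T (f k) '' J ∩ closedBall x r).Nonempty).card : ℝ) ≤ M)
    (hQ0 : 0 ≤ Q) (hQ : ∀ k, wp p (f k) * μ.real (wT T (f k) ⁻¹' A) ≤ Q) :
    μ.real (closedBall x r ∩ A) ≤ M * Q := by
  have := S.prob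
  rw [hf.dec _ (measurableSet_closedBall.inter hA)]
  have h1 : ∀ k, wp p (f k) * μ.real (wT T (f k) ⁻¹' (closedBall x r ∩ A)) ≤
      if (wT T (f k) '' J ∩ closedBall x r).Nonempty then Q else 0 := by
    intro k
    split_ifs with h
    · refine le_trans ?_ (hQ k)
      exact mul_le_mul_of_nonneg_left (measureReal_mono (preimage_mono inter_subset_right))
        (wp_pos S.hp _).le
    · have : μ.real (wT T (f k) ⁻¹' (closedBall x r ∩ A)) = 0 := by
        refine measureReal_mono_null (s₂ := Jᶜ) ?_ (by simp [Measure.real, S.μJ])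
        intro y hy hyJ
        exact h ⟨_, mem_image_of_mem _ hyJ, hy.1⟩
      rw [this, mul_zero]
  refine (Finset.sum_le_sum fun k _ => h1 k).trans ?_
  rw [← Finset.sum_filter, Finset.sum_const, nsmul_eq_mul]
  exact mul_le_mul_of_nonneg_right hM hQ0

end
end SS

namespace SS
section
variable {s : ℕ} {T : Fin s → ℂ → ℂ} {lam : Fin s → ℝ}
    {rot : Fin s → ℂ ≃ₗᵢ[ℝ] ℂ} {z : Fin s → ℂ} {J Op : Set ℂ} {p : Fin s → ℝ}
    {μ : Measure ℂ} {l L : ℝ}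

lemma wp_rpow (hl : ∀ i, 0 < lam i) (D : ℝ) (w : List (Fin s)) :
    wp (fun i => lam i ^ D) w = wp lam w ^ D := by
  induction w with
  | nil => simp [wp]
  | cons i w ih => simp only [wp]; rw [ih, Real.mul_rpow (hl i).le (wp_pos hl w).le]

lemma exists_D (hs : 0 < s) (hlam : ∀ i, 0 < lam i ∧ lam i < 1) :
    ∃ D : ℝ, 0 ≤ D ∧ ∑ i, lam i ^ D = 1 := by
  have hc : Continuous fun t : ℝ => ∑ i, lam i ^ t :=
    continuous_finsetSum _ fun i _ => Real.continuous_const_rpow (hlam i).1.ne'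
  have ht : Filter.Tendsto (fun t : ℝ => ∑ i, lam i ^ t) Filter.atTop (nhds (∑ _i : Fin s, 0)) :=
    tendsto_finsetSum _ fun i _ =>
      tendsto_rpow_atTop_of_base_lt_one _ (by linarith [(hlam i).1]) (hlam i).2
  simp only [Finset.sum_const_zero] at ht
  obtain ⟨b, hb1, hb0⟩ := ((ht.eventually (gt_mem_nhds (zero_lt_one' ℝ))).and
    (Filter.eventually_ge_atTop (0:ℝ))).exists
  have h0 : (1:ℝ) ≤ ∑ i, lam i ^ (0:ℝ) := by
    simp only [Real.rpow_zero, Finset.sum_const, Finset.card_univ, Fintype.card_fin, nsmul_eq_mul,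
      mul_one]
    exact_mod_cast hs
  obtain ⟨D, hD, hD1⟩ := intermediate_value_Icc' hb0 hc.continuousOn ⟨hb1.le, h0⟩
  exact ⟨D, hD.1, hD1⟩

lemma Sys.ball_le {D : ℝ} (hD : 0 ≤ D) (S : Sys T lam rot z J Op (fun i => lam i ^ D) μ l L) :
    ∃ M : ℝ, 0 < M ∧ ∀ r, 0 < r → r ≤ 1 → ∀ x, μ.real (closedBall x r) ≤ M * r ^ D := by
  have := S.prob
  obtain ⟨M, hM0, hM⟩ := S.count
  refine ⟨M, hM0, fun r h0 h1 x => ?_⟩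
  obtain ⟨ι, _, f, hf⟩ := S.cut' h0 h1
  have := S.local (Q := r ^ D) hf x univ MeasurableSet.univ (hM r h0 h1 ι _ f hf x)
    (by positivity) ?_
  · simpa using this
  · intro k
    simp only [preimage_univ, probReal_univ, mul_one]
    rw [wp_rpow S.lpos]
    exact Real.rpow_le_rpow (wp_pos S.lpos _).le (hf.hi k) hD

lemma Sys.dimH_le {D : ℝ} (hD : 0 ≤ D) (S : Sys T lam rot z J Op (fun i => lam i ^ D) μ l L) :
    dimH J ≤ ENNReal.ofReal D := by
  have := S.prob
  have hc : ∀ n : ℕ, ∃ (ι : Type) (_ : Fintype ι) (f : ι → List (Fin s)),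
      Cut T lam J Op (fun i => lam i ^ D) μ (l * (1/((n:ℝ)+1))) (1/((n:ℝ)+1)) ι f := fun n =>
    S.cut' (by positivity) (by rw [div_le_one (by positivity)]; linarith [n.cast_nonneg (α := ℝ)])
  choose ι hι f hf using hc
  have hed : ∀ w : List (Fin s), ediam (wT T w '' J) ≤ ENNReal.ofReal (wp lam w * diam J) := by
    intro w
    refine ediam_le ?_
    rintro _ ⟨x, hx, rfl⟩ _ ⟨y, hy, rfl⟩
    rw [edist_dist, S.wdist]
    exact ENNReal.ofReal_le_ofReal (mul_le_mul_of_nonneg_left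
      (dist_le_diam_of_mem S.Jc.isBounded hx hy) (wp_pos S.lpos w).le)
  have h := Measure.hausdorffMeasure_le_liminf_sum (ι := ι) D J (l := Filter.atTop)
    (fun n : ℕ => ENNReal.ofReal (1/((n:ℝ)+1) * diam J)) ?_
    (fun n k => wT T (f n k) '' J) ?_ ?_
  · have h2 : μH[D] J ≤ ENNReal.ofReal (diam J ^ D) := by
      refine h.trans ?_
      refine (Filter.liminf_le_liminf (v := fun _ : ℕ => ENNReal.ofReal (diam J ^ D))
        (Filter.Eventually.of_forall fun n => ?_)).trans (by simp)
      have hsum : ∑ k, wp (fun i => lam i ^ D) (f n k) = 1 := by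
        have := (hf n).dec univ MeasurableSet.univ
        simpa using this.symm
      have h3 : ∀ k, ediam (wT T (f n k) '' J) ^ D ≤
          ENNReal.ofReal (wp (fun i => lam i ^ D) (f n k) * diam J ^ D) := by
        intro k
        rw [wp_rpow S.lpos, ← Real.mul_rpow (wp_pos S.lpos _).le diam_nonneg,
          ← ENNReal.ofReal_rpow_of_nonneg (mul_nonneg (wp_pos S.lpos _).le diam_nonneg) hD]
        exact ENNReal.rpow_le_rpow (hed _) hD
      refine (Finset.sum_le_sum fun k _ => h3 k).trans ?_
      rw [← ENNReal.ofReal_sum_of_nonneg, ← Finset.sum_mul, hsum, one_mul]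
      intro k _
      exact mul_nonneg (wp_pos S.hp _).le (Real.rpow_nonneg diam_nonneg _)
    have h4 : μH[(D.toNNReal : ℝ)] J ≠ ⊤ := by
      rw [Real.coe_toNNReal _ hD]
      exact (h2.trans_lt ENNReal.ofReal_lt_top).ne
    exact dimH_le_of_hausdorffMeasure_ne_top h4
  · have : Filter.Tendsto (fun n : ℕ => 1/((n:ℝ)+1) * diam J) Filter.atTop (nhds (0 * diam J)) :=
      tendsto_one_div_add_atTop_nhds_zero_nat.mul_const _
    rw [zero_mul] at this
    simpa [Function.comp_def] using (ENNReal.continuous_ofReal.tendsto 0).comp this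
  · refine Filter.Eventually.of_forall fun n k => (hed _).trans (ENNReal.ofReal_le_ofReal ?_)
    exact mul_le_mul_of_nonneg_right ((hf n).hi k) diam_nonneg
  · exact Filter.Eventually.of_forall fun n => (hf n).cov

lemma Sys.le_dimH {D : ℝ} (hD : 0 ≤ D) (S : Sys T lam rot z J Op (fun i => lam i ^ D) μ l L) :
    ENNReal.ofReal D ≤ dimH J := by
  have := S.prob
  rcases hD.eq_or_lt with rfl | hD'
  · simp
  obtain ⟨M, hM0, hM⟩ := S.ball_le hD
  have hμJ : μ J = 1 := by
    have := prob_compl_eq_zero_iff (μ := μ) S.Jc.isClosed.measurableSet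
    exact this.1 S.μJ
  have hkey : ∀ A : Set ℂ, ediam A ≤ 1 → μ A ≤ ENNReal.ofReal M * ediam A ^ D := by
    intro A hA
    rcases A.eq_empty_or_nonempty with rfl | ⟨x, hx⟩
    · simp
    have hfin : ediam A ≠ ⊤ := (hA.trans_lt ENNReal.one_lt_top).ne
    have hsub : ∀ r, (ediam A).toReal ≤ r → A ⊆ closedBall x r := by
      intro r hr y hy
      rw [mem_closedBall]
      refine le_trans ?_ hr
      rw [dist_edist]
      exact ENNReal.toReal_mono hfin (edist_le_ediam_of_mem hy hx)
    have hb : ∀ r, 0 < r → r ≤ 1 → (ediam A).toReal ≤ r → μ A ≤ ENNReal.ofReal (M * r ^ D) := by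
      intro r h0 h1 h2
      refine (measure_mono (hsub r h2)).trans ?_
      rw [← ofReal_measureReal]
      exact ENNReal.ofReal_le_ofReal (hM r h0 h1 x)
    have h1 : (ediam A).toReal ≤ 1 := by
      simpa using ENNReal.toReal_mono ENNReal.one_ne_top hA
    rcases (ENNReal.toReal_nonneg (a := ediam A)).eq_or_lt with h0 | h0
    · have h2 : μ A ≤ 0 := by
        have hT : Filter.Tendsto (fun r : ℝ => ENNReal.ofReal (M * r ^ D))
            (nhdsWithin 0 (Ioi 0)) (nhds (ENNReal.ofReal (M * 0 ^ D))) := by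
          refine (ENNReal.continuous_ofReal.tendsto _).comp ?_
          refine Filter.Tendsto.const_mul _ ?_
          exact ((Real.continuous_rpow_const hD).tendsto 0).mono_left nhdsWithin_le_nhds
        rw [Real.zero_rpow hD'.ne', mul_zero, ENNReal.ofReal_zero] at hT
        refine ge_of_tendsto hT ?_
        filter_upwards [Ioc_mem_nhdsGT (zero_lt_one' ℝ)] with r hr
        exact hb r hr.1 hr.2 (h0 ▸ hr.1.le)
      exact h2.trans (zero_le)
    · refine (hb _ h0 h1 le_rfl).trans ?_
      rw [ENNReal.ofReal_mul hM0.le, ← ENNReal.ofReal_rpow_of_pos h0, ENNReal.ofReal_toReal hfin]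
  have h1 : (ENNReal.ofReal M)⁻¹ • μ ≤ μH[D] := by
    refine Measure.le_hausdorffMeasure D _ 1 one_pos fun A hA => ?_
    rw [Measure.smul_apply, smul_eq_mul]
    refine (mul_le_mul_right (hkey A hA) _).trans ?_
    rw [← mul_assoc, ENNReal.inv_mul_cancel (by simpa using hM0) ENNReal.ofReal_ne_top, one_mul]
  have h2 : μH[(D.toNNReal : ℝ)] J ≠ 0 := by
    rw [Real.coe_toNNReal _ hD]
    have := h1 J
    rw [Measure.smul_apply, hμJ, smul_eq_mul, mul_one] at this
    intro h
    rw [h] at this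
    simp at this
  exact le_dimH_of_hausdorffMeasure_ne_zero h2

/-- existence of a good system in dimension one -/
lemma exists_sys (T : Fin s → ℂ → ℂ) (lam : Fin s → ℝ)
    (rot : Fin s → ℂ ≃ₗᵢ[ℝ] ℂ) (z : Fin s → ℂ)
    (hlam : ∀ i, 0 < lam i ∧ lam i < 1)
    (hT : ∀ i x, T i x = lam i • (rot i x) + z i)
    (J : Set ℂ) (hJc : IsCompact J) (hJne : J.Nonempty)
    (hself : J = ⋃ i, T i '' J)
    (hOSC : ∃ Op : Set ℂ, IsOpen Op ∧ Op.Nonempty ∧ (⋃ i, T i '' Op) ⊆ Op ∧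
      ∀ i j, i ≠ j → Disjoint (T i '' Op) (T j '' Op))
    (hdim : dimH J = 1) : ∃ Op μ l L, Sys T lam rot z J Op lam μ l L := by
  obtain ⟨Op, hO1, hO2, hO3, hO4⟩ := hOSC
  have hs : Nonempty (Fin s) := by
    obtain ⟨x, hx⟩ := hJne
    rw [hself] at hx
    exact ⟨(mem_iUnion.1 hx).choose⟩
  obtain ⟨i0, hi0⟩ := Finite.exists_min lam
  obtain ⟨i1, hi1⟩ := Finite.exists_max lam
  obtain ⟨D, hD0, hD1⟩ := exists_D (Fin.pos_iff_nonempty.2 hs) hlam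
  have hTd : ∀ i x y, dist (T i x) (T i y) = lam i * dist x y := fun i x y => by
    rw [hT, hT, dist_add_right, dist_smul₀, (rot i).dist_map, Real.norm_of_nonneg (hlam i).1.le]
  have hJi : ∀ i, T i '' J ⊆ J := fun i => by
    conv_rhs => rw [hself]
    exact subset_iUnion (fun i => T i '' J) i
  obtain ⟨μ, h1, h2, h3⟩ := exists_measure T lam (lam i1) (hlam i1).2 (hlam i1).1.le hi1 hTd J hJc
    hJne hJi (fun i => lam i ^ D) (fun i => (Real.rpow_pos_of_pos (hlam i).1 _).le) hD1
  have S : Sys T lam rot z J Op (fun i => lam i ^ D) μ (lam i0) (lam i1) :=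
    ⟨(hlam i0).1, (hlam i0).2.le, hi0, hi1, (hlam i1).2, (hlam i1).1, hT, hJc, hJne, hself, hO1,
      hO2, fun i => (subset_iUnion (fun i => T i '' Op) i).trans hO3, hO4,
      fun i => Real.rpow_pos_of_pos (hlam i).1 _, h1, h2, h3⟩
  have hD : D = 1 := by
    have ha := S.dimH_le hD0
    have hb := S.le_dimH hD0
    rw [hdim] at ha hb
    have := le_antisymm hb ha
    simpa using this
  subst hD
  simp only [Real.rpow_one] at S
  exact ⟨Op, μ, _, _, S⟩

end
end SS

namespace SS

def strip (u : ℂ) (c ε : ℝ) : Set ℂ := {x | |inner ℝ u x - c| ≤ ε}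

lemma strip_meas (u : ℂ) (c ε : ℝ) : MeasurableSet (strip u c ε) := by
  refine IsClosed.measurableSet ?_
  exact isClosed_le (by fun_prop) continuous_const

lemma strip_mono {u : ℂ} {c ε ε' : ℝ} (h : ε ≤ ε') : strip u c ε ⊆ strip u c ε' :=
  fun _ hx => le_trans (show _ ≤ _ from hx) h

/-- noncollinear sets are not in thin strips -/
lemma not_strip {J : Set ℂ} (hJne : J.Nonempty) (hline : ¬ Collinear ℝ J) :
    ∃ ε > 0, ∀ u : ℂ, ‖u‖ = 1 → ∀ c : ℝ, ∃ x ∈ J, x ∉ strip u c ε := by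
  obtain ⟨a, ha⟩ := hJne
  have h1 : ∃ b ∈ J, ∃ d ∈ J, ((b - a) * (starRingEnd ℂ) (d - a)).im ≠ 0 := by
    by_contra hcon
    push Not at hcon
    apply hline
    by_cases hb : ∃ b ∈ J, b ≠ a
    · obtain ⟨b, hb, hba⟩ := hb
      rw [collinear_iff_of_mem ha]
      refine ⟨b - a, fun d hd => ⟨((d - a) / (b - a)).re, ?_⟩⟩
      have h0 := hcon d hd b hb
      have hba' : b - a ≠ 0 := sub_ne_zero.2 hba
      have h2 : ((d - a) / (b - a)).im = 0 := by
        rw [div_eq_mul_inv, Complex.inv_def, ← mul_assoc, Complex.im_mul_ofReal, h0, zero_mul]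
      have h3 : ((((d - a) / (b - a)).re : ℝ) : ℂ) = (d - a) / (b - a) :=
        Complex.ext (by simp) (by simp [h2])
      rw [Complex.real_smul, h3, div_mul_cancel₀ _ hba']
      simp
    · push Not at hb
      exact (collinear_singleton ℝ a).subset (fun x hx => hb x hx)
  obtain ⟨b, hb, d, hd, hbd⟩ := h1
  set Δ := |((b - a) * (starRingEnd ℂ) (d - a)).im| with hΔ
  have hΔ0 : 0 < Δ := abs_pos.2 hbd
  set N := ‖b - a‖ + ‖d - a‖ with hN
  have hN0 : 0 ≤ N := by positivity
  refine ⟨Δ / (4 * (N + 1)), by positivity, fun u hu c => ?_⟩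
  by_contra hcon
  push Not at hcon
  have ha' : |_ - c| ≤ _ := hcon a ha
  have hb' : |_ - c| ≤ _ := hcon b hb
  have hd' : |_ - c| ≤ _ := hcon d hd
  set e := Δ / (4 * (N + 1)) with he
  have he0 : 0 < e := by positivity
  have hb2 : |inner ℝ u (b - a)| ≤ 2 * e := by
    rw [inner_sub_right]
    calc _ = |(inner ℝ u b - c) - (inner ℝ u a - c)| := by congr 1; ring
      _ ≤ _ := abs_sub _ _
      _ ≤ _ := by linarith
  have hd2 : |inner ℝ u (d - a)| ≤ 2 * e := by
    rw [inner_sub_right]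
    calc _ = |(inner ℝ u d - c) - (inner ℝ u a - c)| := by congr 1; ring
      _ ≤ _ := abs_sub _ _
      _ ≤ _ := by linarith
  -- identity
  have hid : ∀ v w : ℂ, (v * (starRingEnd ℂ) w).im =
      inner ℝ (u * Complex.I) v * inner ℝ u w - inner ℝ u v * inner ℝ (u * Complex.I) w := by
    intro v w
    have hn : u.re * u.re + u.im * u.im = 1 := by
      have := Complex.normSq_eq_norm_sq u
      rw [hu, Complex.normSq_apply] at this
      simpa using this
    simp only [Complex.inner, Complex.mul_re, Complex.mul_im, Complex.conj_re, Complex.conj_im,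
      Complex.I_re, Complex.I_im, map_mul]
    linear_combination (-(v.im * w.re) + v.re * w.im) * hn
  have hI : ∀ v : ℂ, |inner ℝ (u * Complex.I) v| ≤ ‖v‖ := by
    intro v
    refine (abs_real_inner_le_norm _ _).trans ?_
    simp [hu]
  have h5 : Δ ≤ N * (2 * e) := by
    rw [hΔ, hid]
    calc _ ≤ _ := abs_sub _ _
      _ = |inner ℝ (u * Complex.I) (b - a)| * |inner ℝ u (d - a)| +
          |inner ℝ u (b - a)| * |inner ℝ (u * Complex.I) (d - a)| := by rw [abs_mul, abs_mul]
      _ ≤ ‖b - a‖ * (2 * e) + (2 * e) * ‖d - a‖ := by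
          gcongr
          · exact hI _
          · exact hI _
      _ = _ := by rw [hN]; ring
  have h6 : e * (4 * (N + 1)) = Δ := by rw [he]; field_simp
  nlinarith

section
variable {s : ℕ} {T : Fin s → ℂ → ℂ} {lam : Fin s → ℝ}
    {rot : Fin s → ℂ ≃ₗᵢ[ℝ] ℂ} {z : Fin s → ℂ} {J Op : Set ℂ} {p : Fin s → ℝ}
    {μ : Measure ℂ} {l L : ℝ}

lemma Sys.strip_pre (S : Sys T lam rot z J Op p μ l L) (w : List (Fin s)) :
    ∀ (u : ℂ) (c ε : ℝ), ‖u‖ = 1 → ∃ (u' : ℂ) (c' : ℝ), ‖u'‖ = 1 ∧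
      wT T w ⁻¹' strip u c ε = strip u' c' (ε / wp lam w) := by
  induction w with
  | nil => intro u c ε hu; exact ⟨u, c, hu, by simp [wT, wp]⟩
  | cons i w ih =>
    intro u c ε hu
    obtain ⟨u', c', hu', h⟩ := ih ((rot i).symm u) ((c - inner ℝ u (z i)) / lam i) (ε / lam i)
      (by simpa using hu)
    refine ⟨u', c', hu', ?_⟩
    rw [wT, preimage_comp, wp, ← div_div, ← h]
    congr 1
    ext x
    have hi := S.lpos i
    simp only [strip, mem_preimage, mem_ofPred_eq]
    have h1 : inner ℝ u (T i x) - c =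
        lam i * (inner ℝ ((rot i).symm u) x - (c - inner ℝ u (z i)) / lam i) := by
      rw [S.hT, inner_add_right, inner_smul_right]
      have : inner ℝ ((rot i).symm u) x = inner ℝ u (rot i x) := by
        conv_rhs => rw [← (rot i).apply_symm_apply u]
        rw [LinearIsometryEquiv.inner_map_map]
      rw [this]
      field_simp
      ring
    rw [h1, abs_mul, abs_of_pos hi, le_div_iff₀ hi, mul_comm]

lemma Sys.strip_le (S : Sys T lam rot z J Op p μ l L) (hline : ¬ Collinear ℝ J) :
    ∃ κ C : ℝ, 0 < κ ∧ κ ≤ 1 ∧ 0 < C ∧ ∀ (u : ℂ) (c ε : ℝ), ‖u‖ = 1 → 0 < ε →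
      μ.real (strip u c ε) ≤ C * ε ^ κ := by
  have := S.prob
  obtain ⟨e, he0, he⟩ := not_strip S.Jne hline
  set d := diam J + 1 with hd
  have hd0 : 0 < d := by have := diam_nonneg (s := J); positivity
  set r := min 1 (e / 2 / d) with hr
  have hr0 : 0 < r := by positivity
  have hr1 : r ≤ 1 := min_le_left _ _
  have hrd : r * d ≤ e / 2 := by
    have := min_le_right 1 (e / 2 / d)
    rwa [← hr, le_div_iff₀ hd0] at this
  obtain ⟨ι, _, f, hf⟩ := S.cut' hr0 hr1
  have hsum : ∑ k, wp p (f k) = 1 := by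
    have := hf.dec univ MeasurableSet.univ
    simpa using this.symm
  have hι : Nonempty ι := by
    by_contra h
    rw [not_nonempty_iff] at h
    simp at hsum
  obtain ⟨k1, hk1⟩ := Finite.exists_min (fun k => wp p (f k))
  set q := wp p (f k1) with hq
  have hq0 : 0 < q := wp_pos S.hp _
  set a := l * r with ha
  have hl0 := S.l0
  have ha0 : 0 < a := by positivity
  have ha1 : a < 1 := by
    obtain ⟨y, hy⟩ := S.Jne
    rw [S.self] at hy
    obtain ⟨i, -⟩ := mem_iUnion.1 hy
    have : l < 1 := (S.hl i).trans_lt ((S.hL i).trans_lt S.L1)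
    calc a ≤ l * 1 := by rw [ha]; gcongr
      _ < 1 := by linarith
  set θ := max (1 - q) a with hθ
  have hθ0 : 0 < θ := lt_max_of_lt_right ha0
  have hθ1 : θ < 1 := max_lt (by linarith) ha1
  -- recursion
  have hrec : ∀ B : ℝ, ∀ ε, ε ≤ e / 2 →
      (∀ (u : ℂ) (c : ℝ), ‖u‖ = 1 → μ.real (strip u c (ε / a)) ≤ B) →
      0 ≤ ε → ∀ (u : ℂ) (c : ℝ), ‖u‖ = 1 → μ.real (strip u c ε) ≤ θ * B := by
    intro B ε hε hB hε0 u c hu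
    have hB0 : 0 ≤ B := measureReal_nonneg.trans (hB u c hu)
    obtain ⟨x, hxJ, hx⟩ := he u hu c
    obtain ⟨k0, y, hy, rfl⟩ := mem_iUnion.1 (hf.cov hxJ)
    have hz : μ.real (wT T (f k0) ⁻¹' strip u c ε) = 0 := by
      refine measureReal_mono_null (s₂ := Jᶜ) ?_ (by simp [Measure.real, S.μJ])
      intro v hv hvJ
      apply hx
      have hv' : |inner ℝ u (wT T (f k0) v) - c| ≤ ε := hv
      have h1 : |inner ℝ u (wT T (f k0) y) - inner ℝ u (wT T (f k0) v)| ≤ e / 2 := by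
        rw [← inner_sub_right]
        refine (abs_real_inner_le_norm _ _).trans ?_
        rw [hu, one_mul, ← dist_eq_norm, S.wdist]
        refine le_trans (mul_le_mul (hf.hi k0) (?_ : Dist.dist y v ≤ d) dist_nonneg hr0.le) hrd
        exact (dist_le_diam_of_mem S.Jc.isBounded hy hvJ).trans (by linarith)
      change |_| ≤ e
      calc _ = |(inner ℝ u (wT T (f k0) y) - inner ℝ u (wT T (f k0) v)) +
            (inner ℝ u (wT T (f k0) v) - c)| := by congr 1; ring
        _ ≤ _ := abs_add_le _ _
        _ ≤ e := by linarith
    classical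
    rw [hf.dec _ (strip_meas _ _ _), ← Finset.add_sum_erase _ _ (Finset.mem_univ k0), hz, mul_zero,
      zero_add]
    have h2 : ∀ k, μ.real (wT T (f k) ⁻¹' strip u c ε) ≤ B := by
      intro k
      obtain ⟨u', c', hu', h⟩ := S.strip_pre (f k) u c ε hu
      rw [h]
      refine (measureReal_mono (strip_mono ?_)).trans (hB u' c' hu')
      exact div_le_div_of_nonneg_left hε0 ha0 (hf.lo k)
    calc _ ≤ ∑ k ∈ Finset.univ.erase k0, wp p (f k) * B :=
          Finset.sum_le_sum fun k _ => mul_le_mul_of_nonneg_left (h2 k) (wp_pos S.hp _).le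
      _ = (1 - wp p (f k0)) * B := by
          rw [← Finset.sum_mul, ← hsum, ← Finset.add_sum_erase _ _ (Finset.mem_univ k0)]; ring
      _ ≤ θ * B := by
          have := hk1 k0
          have : 1 - wp p (f k0) ≤ θ := le_trans (by linarith) (le_max_left _ _)
          gcongr
  have hpow : ∀ n : ℕ, ∀ (u : ℂ) (c : ℝ), ‖u‖ = 1 →
      μ.real (strip u c (a ^ n * (e / 2))) ≤ θ ^ n * θ⁻¹ := by
    intro n
    induction n with
    | zero =>
      intro u c _
      refine (measureReal_le_one).trans ?_
      rw [pow_zero, one_mul]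
      exact (one_le_inv₀ hθ0).2 hθ1.le
    | succ n ih =>
      intro u c hu
      rw [pow_succ' θ, mul_assoc]
      refine hrec _ _ ?_ ?_ (by positivity) u c hu
      · have : a ^ (n+1) ≤ 1 := pow_le_one₀ ha0.le ha1.le
        nlinarith
      · intro u c hu
        have : a ^ (n+1) * (e / 2) / a = a ^ n * (e / 2) := by rw [pow_succ]; field_simp
        rw [this]
        exact ih u c hu
  -- exponent
  have hla : Real.log a < 0 := Real.log_neg ha0 ha1
  have hlθ : Real.log θ < 0 := Real.log_neg hθ0 hθ1
  set κ := Real.log θ / Real.log a with hκ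
  have hκ0 : 0 < κ := div_pos_of_neg_of_neg hlθ hla
  have hκ1 : κ ≤ 1 := by
    rw [hκ, div_le_one_of_neg hla]
    exact Real.log_le_log ha0 (le_max_right _ _)
  have haκ : a ^ κ = θ := by
    rw [Real.rpow_def_of_pos ha0, hκ, mul_div_cancel₀ _ hla.ne, Real.exp_log hθ0]
  refine ⟨κ, (e / 2) ^ (-κ) * θ⁻¹ * θ⁻¹, hκ0, hκ1, by positivity, fun u c ε hu hε => ?_⟩
  by_cases hbig : e / 2 < ε
  · refine measureReal_le_one.trans ?_
    have h1 : 1 ≤ (e / 2) ^ (-κ) * ε ^ κ := by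
      rw [Real.rpow_neg (by positivity), ← Real.inv_rpow (by positivity), ← Real.mul_rpow (by positivity) hε.le]
      apply Real.one_le_rpow _ hκ0.le
      rw [← div_eq_inv_mul, le_div_iff₀ (by positivity)]
      linarith
    have h2 : 1 ≤ θ⁻¹ := (one_le_inv₀ hθ0).2 hθ1.le
    calc (1:ℝ) ≤ ((e / 2) ^ (-κ) * ε ^ κ) * (θ⁻¹ * θ⁻¹) := by
          have : 1 ≤ θ⁻¹ * θ⁻¹ := one_le_mul_of_one_le_of_one_le h2 h2
          exact one_le_mul_of_one_le_of_one_le h1 this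
      _ = _ := by ring
  · push Not at hbig
    have hx0 : 0 < ε / (e / 2) := by positivity
    have hx1 : ε / (e / 2) ≤ 1 := by rw [div_le_one (by positivity)]; exact hbig
    obtain ⟨n, hn1, hn2⟩ := exists_nat_pow_near_of_lt_one hx0 hx1 ha0 ha1
    have h1 : μ.real (strip u c ε) ≤ θ ^ n * θ⁻¹ := by
      refine (measureReal_mono (strip_mono ?_)).trans (hpow n u c hu)
      rwa [div_le_iff₀ (by positivity)] at hn2
    refine h1.trans ?_
    have h2 : θ ^ (n+1) ≤ (ε / (e / 2)) ^ κ := by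
      calc θ ^ (n+1) = (a ^ (n+1)) ^ κ := by
            rw [← haκ, ← Real.rpow_natCast, ← Real.rpow_natCast, ← Real.rpow_mul ha0.le, ← Real.rpow_mul ha0.le, mul_comm]
        _ ≤ _ := Real.rpow_le_rpow (by positivity) hn1.le hκ0.le
    rw [Real.div_rpow hε.le (by positivity)] at h2
    calc θ ^ n * θ⁻¹ = θ ^ (n+1) * (θ⁻¹ * θ⁻¹) := by rw [pow_succ]; field_simp
      _ ≤ (ε ^ κ / (e/2) ^ κ) * (θ⁻¹ * θ⁻¹) := by gcongr
      _ = _ := by rw [Real.rpow_neg (by positivity)]; ring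

/-- The abstract regularity package. -/
structure Reg (J : Set ℂ) (μ : Measure ℂ) (κ C c : ℝ) : Prop where
  κ0 : 0 < κ
  κ1 : κ ≤ 1
  C0 : 0 < C
  c0 : 0 < c
  prob : IsProbabilityMeasure μ
  Jc : IsCompact J
  Jne : J.Nonempty
  μJ : μ Jᶜ = 0
  low : ∀ x ∈ J, ∀ r, 0 < r → r ≤ 1 → c * r ≤ μ.real (closedBall x r)
  up : ∀ (u x : ℂ) (t r₁ r₂ : ℝ), ‖u‖ = 1 → 0 < r₁ → r₁ ≤ r₂ →
    μ.real (closedBall x r₂ ∩ strip u t r₁) ≤ C * (r₁ ^ κ * r₂ ^ (1 - κ))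

lemma Sys.reg (S : Sys T lam rot z J Op lam μ l L) (hline : ¬ Collinear ℝ J) :
    ∃ κ C c, Reg J μ κ C c := by
  have := S.prob
  have hl0 := S.l0
  obtain ⟨κ, C, hκ0, hκ1, hC0, hC⟩ := S.strip_le hline
  obtain ⟨M, hM0, hM⟩ := S.count
  set d := diam J + 1 with hd
  have hd0 : 0 < d := by have := diam_nonneg (s := J); positivity
  have hd1 : 1 ≤ d := by have := diam_nonneg (s := J); linarith
  refine ⟨κ, max C (M * (C * l ^ (-κ))), l / d, hκ0, hκ1, lt_max_of_lt_left hC0, by positivity,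
    S.prob, S.Jc, S.Jne, S.μJ, ?_, ?_⟩
  · intro x hx r hr0 hr1
    have hrd : r / d ≤ 1 := (div_le_one hd0).2 (hr1.trans hd1)
    obtain ⟨ι, _, f, hf⟩ := S.cut' (r := r / d) (by positivity) hrd
    obtain ⟨k, y, hy, rfl⟩ := mem_iUnion.1 (hf.cov hx)
    rw [hf.dec _ measurableSet_closedBall]
    have hk : μ.real (wT T (f k) ⁻¹' closedBall (wT T (f k) y) r) = 1 := by
      have h1 : μ.real J = 1 := by
        have := (prob_compl_eq_zero_iff (μ := μ) S.Jc.isClosed.measurableSet).1 S.μJ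
        simp [Measure.real, this]
      refine le_antisymm measureReal_le_one ?_
      rw [← h1]
      refine measureReal_mono fun v hv => ?_
      rw [mem_preimage, mem_closedBall, S.wdist]
      have h2 : Dist.dist v y ≤ d :=
        (dist_le_diam_of_mem S.Jc.isBounded hv hy).trans (by linarith)
      calc _ ≤ r / d * d := mul_le_mul (hf.hi k) h2 dist_nonneg (by positivity)
        _ = r := by field_simp
    have h3 := Finset.single_le_sum (f := fun k' => wp lam (f k') *
      μ.real (wT T (f k') ⁻¹' closedBall (wT T (f k) y) r))
      (fun k' _ => mul_nonneg (wp_pos S.hp _).le measureReal_nonneg) (Finset.mem_univ k)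
    refine le_trans ?_ h3
    simp only [hk, mul_one]
    refine le_trans (le_of_eq ?_) (hf.lo k)
    ring
  · intro u x t r₁ r₂ hu h1 h12
    have h2 : 0 < r₂ := h1.trans_le h12
    by_cases hr : r₂ ≤ 1
    · obtain ⟨ι, _, f, hf⟩ := S.cut' h2 hr
      have h3 := S.local (Q := C * l ^ (-κ) * (r₁ ^ κ * r₂ ^ (1 - κ))) hf x (strip u t r₁)
        (strip_meas _ _ _) (hM r₂ h2 hr ι _ f hf x) (by positivity) ?_
      · refine h3.trans ?_
        rw [← mul_assoc]
        exact mul_le_mul_of_nonneg_right (le_max_right _ _) (by positivity)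
      · intro k
        obtain ⟨u', c', hu', h⟩ := S.strip_pre (f k) u t r₁ hu
        rw [h]
        have hw := wp_pos S.lpos (f k)
        calc _ ≤ r₂ * (C * (r₁ / (l * r₂)) ^ κ) := by
              refine mul_le_mul (hf.hi k) ((hC _ _ _ hu' (by positivity)).trans ?_)
                measureReal_nonneg h2.le
              have := hf.lo k
              gcongr
          _ = _ := by
              rw [Real.div_rpow h1.le (by positivity), Real.mul_rpow hl0.le h2.le,
                Real.rpow_sub h2, Real.rpow_one, Real.rpow_neg hl0.le]
              field_simp
    · push Not at hr
      refine (measureReal_mono inter_subset_right).trans ((hC u t r₁ hu h1).trans ?_)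
      have h4 : 1 ≤ r₂ ^ (1 - κ) := Real.one_le_rpow hr.le (by linarith)
      have h5 : C ≤ max C (M * (C * l ^ (-κ))) := le_max_left _ _
      calc C * r₁ ^ κ = C * (r₁ ^ κ * 1) := by ring
        _ ≤ _ := by gcongr

end
end SS

namespace SS

lemma volstrip {u : ℂ} (hu : ‖u‖ = 1) (x : ℂ) (c : ℝ) {r ρ : ℝ} (hr : 0 ≤ r) (hρ : 0 ≤ ρ) :
    volume.real (closedBall x ρ ∩ strip u c r) ≤ 4 * r * ρ := by
  have hu' : ‖(starRingEnd ℂ) u‖ = 1 := by simpa using hu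
  let b : Circle := ⟨(starRingEnd ℂ) u, by
    simpa [Submonoid.unitSphere] using hu'⟩
  let e := rotation b
  have he : MeasurePreserving e := LinearIsometryEquiv.measurePreserving e
  have hap : ∀ y, e y = (starRingEnd ℂ) u * y := fun y => rotation_apply b y
  let Q : Set (ℝ × ℝ) := Icc (c - r) (c + r) ×ˢ Icc ((e x).im - ρ) ((e x).im + ρ)
  have hQ : MeasurableSet Q := measurableSet_Icc.prod measurableSet_Icc
  have hsub : closedBall x ρ ∩ strip u c r ⊆ e ⁻¹' (Complex.measurableEquivRealProd ⁻¹' Q) := by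
    rintro y ⟨h1, h2⟩
    have h2' : |inner ℝ u y - c| ≤ r := h2
    have hin : inner ℝ u y = (e y).re := by
      rw [hap, Complex.inner, mul_comm]
    rw [hin] at h2'
    have h3 : |(e y).im - (e x).im| ≤ ρ := by
      have := Complex.abs_im_le_norm (e y - e x)
      rw [← map_sub, LinearIsometryEquiv.norm_map, map_sub, Complex.sub_im] at this
      rw [mem_closedBall, dist_eq_norm] at h1
      linarith
    rw [abs_le] at h2' h3
    simp only [mem_preimage, Q, mem_prod, Complex.measurableEquivRealProd_apply, mem_Icc]
    refine ⟨⟨?_, ?_⟩, ?_, ?_⟩ <;> linarith [h2'.1, h2'.2, h3.1, h3.2]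
  have hv : volume (e ⁻¹' (Complex.measurableEquivRealProd ⁻¹' Q)) = ENNReal.ofReal (2 * r) * ENNReal.ofReal (2 * ρ) := by
    rw [he.measure_preimage (Complex.measurableEquivRealProd.measurable hQ).nullMeasurableSet,
      Complex.volume_preserving_equiv_real_prod.measure_preimage hQ.nullMeasurableSet,
      Measure.volume_eq_prod, Measure.prod_prod, Real.volume_Icc, Real.volume_Icc]
    congr 2 <;> ring
  have hle := measure_mono (μ := volume) hsub
  rw [hv, ← ENNReal.ofReal_mul (by positivity)] at hle
  refine (ENNReal.toReal_mono ENNReal.ofReal_ne_top hle).trans ?_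
  rw [ENNReal.toReal_ofReal (by positivity)]
  apply le_of_eq; ring

lemma ball_sub_strip {u : ℂ} (hu : ‖u‖ = 1) (x : ℂ) (r : ℝ) :
    closedBall x r ⊆ strip u (inner ℝ u x) r := by
  intro y hy
  rw [mem_closedBall, dist_eq_norm] at hy
  show |inner ℝ u y - inner ℝ u x| ≤ r
  rw [← inner_sub_right]
  have := abs_real_inner_le_norm u (y - x)
  rw [hu, one_mul] at this
  linarith

lemma volball (x : ℂ) {r : ℝ} (hr : 0 ≤ r) : volume.real (closedBall x r) ≤ 4 * r * r := by
  have h := volstrip (u := 1) (by simp) x (inner ℝ 1 x) hr hr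
  rwa [inter_eq_left.2 (ball_sub_strip (by simp) x r)] at h

lemma volball_ge (x : ℂ) {r : ℝ} (hr : 0 ≤ r) : 3 * r * r ≤ volume.real (closedBall x r) := by
  rw [Measure.real, Complex.volume_closedBall, ENNReal.toReal_mul, ENNReal.toReal_pow, ENNReal.toReal_ofReal hr]
  have : (3:ℝ) ≤ (NNReal.pi : NNReal) := by
    rw [NNReal.coe_real_pi]; exact Real.pi_gt_three.le
  simp only [ENNReal.coe_toReal]
  nlinarith [mul_nonneg hr hr]

variable {J : Set ℂ} {μ : Measure ℂ} {κ C c : ℝ}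

lemma Reg.sep (R : Reg J μ κ C c) {η : ℝ} (h0 : 0 < η) (h1 : η ≤ 1) (t : Finset ℂ)
    (htJ : ∀ x ∈ t, x ∈ J) (hsep : ∀ x ∈ t, ∀ y ∈ t, x ≠ y → η < dist x y)
    (S : Set ℂ) (hS : ∀ x ∈ t, closedBall x (η / 3) ⊆ S) :
    t.card * (c * (η / 3)) ≤ μ.real S := by
  have := R.prob
  have hd : (t : Set ℂ).PairwiseDisjoint (fun x => closedBall x (η / 3)) := by
    intro x hx y hy hxy
    refine closedBall_disjoint_closedBall ?_
    have := hsep x hx y hy hxy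
    linarith
  have h2 : μ.real (⋃ x ∈ t, closedBall x (η / 3)) = ∑ x ∈ t, μ.real (closedBall x (η / 3)) :=
    measureReal_biUnion_finset hd (fun _ _ => measurableSet_closedBall)
  have h3 : (t.card : ℝ) * (c * (η / 3)) ≤ ∑ x ∈ t, μ.real (closedBall x (η / 3)) := by
    rw [← nsmul_eq_mul]
    exact Finset.card_nsmul_le_sum _ _ _ fun x hx => R.low x (htJ x hx) _ (by positivity) (by linarith)
  refine h3.trans (h2 ▸ ?_)
  exact measureReal_mono (iUnion₂_subset hS)

lemma Reg.ball (R : Reg J μ κ C c) (x : ℂ) {r : ℝ} (h0 : 0 < r) :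
    μ.real (closedBall x r) ≤ C * r := by
  have h := R.up 1 x (inner ℝ 1 x) r r (by simp) h0 le_rfl
  rwa [inter_eq_left.2 (ball_sub_strip (by simp) x r), ← Real.rpow_add h0, add_sub_cancel,
    Real.rpow_one] at h

open Classical in
lemma Reg.net (R : Reg J μ κ C c) {η : ℝ} (h0 : 0 < η) (h1 : η ≤ 1) :
    ∃ P : Finset ℂ, P.Nonempty ∧ (∀ x ∈ P, x ∈ J) ∧
      (∀ x ∈ P, ∀ y ∈ P, x ≠ y → η < dist x y) ∧ J ⊆ ⋃ x ∈ P, closedBall x η := by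
  have := R.prob
  let pr : Finset ℂ → Prop := fun t => (∀ x ∈ t, x ∈ J) ∧ (∀ x ∈ t, ∀ y ∈ t, x ≠ y → η < dist x y)
  have hc := R.c0
  obtain ⟨N, hN⟩ := exists_nat_ge (1 / (c * (η / 3)))
  have hb : ∀ t, pr t → t.card ≤ N := by
    intro t ht
    have h := R.sep h0 h1 t ht.1 ht.2 univ (fun _ _ => subset_univ _)
    rw [probReal_univ, ← le_div_iff₀ (by positivity)] at h
    exact_mod_cast h.trans hN
  let n := Nat.findGreatest (fun k => ∃ t, pr t ∧ t.card = k) N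
  have hn : ∃ t, pr t ∧ t.card = n :=
    Nat.findGreatest_spec (P := fun k => ∃ t, pr t ∧ t.card = k) (m := 0) (Nat.zero_le _)
      ⟨∅, ⟨by simp, by simp⟩, rfl⟩
  obtain ⟨P, hP, hPn⟩ := hn
  have hcov : J ⊆ ⋃ x ∈ P, closedBall x η := by
    intro y hy
    by_contra hcon
    simp only [mem_iUnion, mem_closedBall, not_exists, not_le] at hcon
    have hyP : y ∉ P := fun h => by
      have := hcon y h
      rw [dist_self] at this; linarith
    have hpr : pr (insert y P) := by
      refine ⟨?_, ?_⟩
      · intro x hx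
        rcases Finset.mem_insert.1 hx with rfl | hx
        · exact hy
        · exact hP.1 x hx
      · intro x hx w hw hxw
        rcases Finset.mem_insert.1 hx with hx | hx <;> rcases Finset.mem_insert.1 hw with hw | hw
        · exact absurd (hx.trans hw.symm) hxw
        · rw [hx]; exact hcon w hw
        · rw [hw, dist_comm]; exact hcon x hx
        · exact hP.2 x hx w hw hxw
    have h2 : (insert y P).card ≤ n :=
      Nat.le_findGreatest (P := fun k => ∃ t, pr t ∧ t.card = k) (hb _ hpr) ⟨_, hpr, rfl⟩
    rw [Finset.card_insert_of_notMem hyP] at h2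
    omega
  refine ⟨P, ?_, hP.1, hP.2, hcov⟩
  obtain ⟨y, hy⟩ := R.Jne
  obtain ⟨x, hx, -⟩ := mem_iUnion₂.1 (hcov hy)
  exact ⟨x, hx⟩

lemma Reg.card_ge (R : Reg J μ κ C c) {η : ℝ} (h0 : 0 < η) (P : Finset ℂ)
    (hcov : J ⊆ ⋃ x ∈ P, closedBall x η) : 1 ≤ P.card * (C * η) := by
  have := R.prob
  have h1 : μ.real (⋃ x ∈ P, closedBall x η) = 1 := by
    have : μ (⋃ x ∈ P, closedBall x η) = 1 := by
      refine (prob_compl_eq_zero_iff₀ ?_).1 ?_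
      · exact (P.measurableSet_biUnion fun _ _ => measurableSet_closedBall).nullMeasurableSet
      · exact measure_mono_null (compl_subset_compl.2 hcov) R.μJ
    rw [Measure.real, this]; rfl
  rw [← h1, ← nsmul_eq_mul]
  exact (measureReal_biUnion_finset_le _ _).trans
    (Finset.sum_le_card_nsmul _ _ _ fun x _ => R.ball x h0)

end SS

namespace SS

variable {J : Set ℂ} {μ : Measure ℂ} {κ C c : ℝ}

lemma strip_thick {u : ℂ} (hu : ‖u‖ = 1) {t r s : ℝ} {y w : ℂ} (hy : y ∈ strip u t r)
    (h : dist w y ≤ s) : w ∈ strip u t (r + s) := by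
  have h1 : |inner ℝ u y - t| ≤ r := hy
  have h2 : |inner ℝ u w - inner ℝ u y| ≤ s := ball_sub_strip hu y s h
  show |inner ℝ u w - t| ≤ r + s
  rw [abs_le] at *
  constructor <;> linarith [h1.1, h1.2, h2.1, h2.2]

open Classical in
lemma Reg.key (R : Reg J μ κ C c) {η : ℝ} (h0 : 0 < η) (h1 : η ≤ 1) (P : Finset ℂ)
    (hPJ : ∀ x ∈ P, x ∈ J) (hsep : ∀ x ∈ P, ∀ y ∈ P, x ≠ y → η < dist x y)
    (u x : ℂ) (t r₁ r₂ : ℝ) (hu : ‖u‖ = 1) (hr : 0 < r₁) (hr2 : r₁ ≤ r₂) :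
    volume.real ((⋃ y ∈ P, closedBall y (2 * η)) ∩ (closedBall x r₂ ∩ strip u t r₁)) ≤
      (4 + 192 * C / c) * (r₁ ^ κ * r₂ ^ (1 - κ)) * η := by
  have := R.prob
  have hc := R.c0
  have hC := R.C0
  have hκ := R.κ0
  have hκ1 : 0 ≤ 1 - κ := by linarith [R.κ1]
  have hr20 : 0 < r₂ := by linarith
  have hspl : ∀ a : ℝ, 0 < a → a = a ^ κ * a ^ (1 - κ) := by
    intro a ha
    rw [← Real.rpow_add ha, add_sub_cancel, Real.rpow_one]
  have hX : 0 ≤ r₁ ^ κ * r₂ ^ (1 - κ) := by positivity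
  have hfin : ∀ (y : ℂ) (ρ : ℝ) (S : Set ℂ), volume (closedBall y ρ ∩ S) ≠ ⊤ := fun y ρ S =>
    measure_ne_top_of_subset inter_subset_left measure_closedBall_lt_top.ne
  rcases le_total r₂ η with hcase | hcase
  · have e1 : volume.real ((⋃ y ∈ P, closedBall y (2 * η)) ∩ (closedBall x r₂ ∩ strip u t r₁)) ≤
        4 * r₁ * r₂ :=
      (measureReal_mono inter_subset_right (hfin _ _ _)).trans (volstrip hu x t hr.le hr20.le)
    have e2 : r₁ ≤ r₁ ^ κ * r₂ ^ (1 - κ) := by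
      conv_lhs => rw [hspl r₁ hr]
      gcongr
    have e3 : 4 * r₁ * r₂ ≤ 4 * (r₁ ^ κ * r₂ ^ (1 - κ)) * η := by gcongr
    have e4 : 0 ≤ 192 * C / c * (r₁ ^ κ * r₂ ^ (1 - κ)) * η := by positivity
    linarith
  · set m := max r₁ η with hm
    set n := min r₁ η with hn
    have hm0 : 0 < m := lt_max_of_lt_left hr
    have hn0 : 0 < n := lt_min hr h0
    have hmn : m ^ κ * n ≤ r₁ ^ κ * η := by
      rcases le_total r₁ η with h | h
      · rw [hm, hn, max_eq_right h, min_eq_left h]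
        conv_lhs => rw [hspl r₁ hr]
        conv_rhs => rw [hspl η h0]
        have : r₁ ^ (1 - κ) ≤ η ^ (1 - κ) := by gcongr
        have h5 : 0 ≤ η ^ κ * r₁ ^ κ := by positivity
        nlinarith
      · rw [hm, hn, max_eq_left h, min_eq_right h]
    let Q := P.filter (fun y => (closedBall y (2 * η) ∩ (closedBall x r₂ ∩ strip u t r₁)).Nonempty)
    have hsub : (⋃ y ∈ P, closedBall y (2 * η)) ∩ (closedBall x r₂ ∩ strip u t r₁) ⊆
        ⋃ y ∈ Q, (closedBall y (2 * η) ∩ strip u t r₁) := by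
      rintro w ⟨hw, hw2⟩
      obtain ⟨y, hy, hyw⟩ := mem_iUnion₂.1 hw
      exact mem_iUnion₂.2 ⟨y, Finset.mem_filter.2 ⟨hy, w, hyw, hw2⟩, hyw, hw2.2⟩
    have hv : ∀ y, volume.real (closedBall y (2 * η) ∩ strip u t r₁) ≤ 16 * η * n := by
      intro y
      rcases le_total r₁ η with h | h
      · rw [hn, min_eq_left h]
        have := volstrip hu y t hr.le (show 0 ≤ 2 * η by positivity)
        nlinarith [mul_pos hr h0]
      · rw [hn, min_eq_right h]
        refine (measureReal_mono inter_subset_left measure_closedBall_lt_top.ne).trans ?_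
        refine (volball y (show 0 ≤ 2 * η by positivity)).trans ?_
        apply le_of_eq; ring
    have hV : volume.real ((⋃ y ∈ P, closedBall y (2 * η)) ∩ (closedBall x r₂ ∩ strip u t r₁)) ≤
        Q.card * (16 * η * n) := by
      refine (measureReal_mono hsub ?_).trans ?_
      · refine ((measure_biUnion_lt_top Q.finite_toSet ?_)).ne
        intro y _
        exact (hfin _ _ _).lt_top
      · refine (measureReal_biUnion_finset_le _ _).trans ?_
        rw [← nsmul_eq_mul]
        exact Finset.sum_le_card_nsmul _ _ _ fun y _ => hv y
    have hN : Q.card * (c * (η / 3)) ≤ C * ((4 * m) ^ κ * (4 * r₂) ^ (1 - κ)) := by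
      refine (R.sep h0 h1 Q (fun y hy => hPJ y (Finset.mem_filter.1 hy).1)
        (fun y hy w hw h => hsep y (Finset.mem_filter.1 hy).1 w (Finset.mem_filter.1 hw).1 h)
        (closedBall x (4 * r₂) ∩ strip u t (4 * m)) ?_).trans ?_
      · intro y hy w hw
        obtain ⟨-, q, hq1, hq2, hq3⟩ := Finset.mem_filter.1 hy
        rw [mem_closedBall] at *
        have hwq : dist w q ≤ 3 * η := by
          have := dist_triangle w y q
          rw [dist_comm y q] at this
          linarith
        refine ⟨?_, ?_⟩
        · rw [mem_closedBall]
          linarith [dist_triangle w q x]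
        · refine strip_mono ?_ (strip_thick hu hq3 hwq)
          linarith [le_max_left r₁ η, le_max_right r₁ η]
      · refine R.up u x t _ _ hu (by positivity) ?_
        have : m ≤ r₂ := max_le hr2 hcase
        linarith
    rw [Real.mul_rpow (by norm_num) hm0.le, Real.mul_rpow (by norm_num) hr20.le] at hN
    have h4 : (4:ℝ) = (4:ℝ) ^ κ * 4 ^ (1 - κ) := hspl 4 (by norm_num)
    have hN' : (Q.card : ℝ) * (c * (η / 3)) ≤ C * (4 * (m ^ κ * r₂ ^ (1 - κ))) := by
      refine hN.trans (le_of_eq ?_)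
      conv_rhs => rw [h4]
      ring
    have hN2 : (Q.card : ℝ) * η ≤ 12 * C / c * (m ^ κ * r₂ ^ (1 - κ)) := by
      rw [div_mul_eq_mul_div, le_div_iff₀ hc]
      linarith
    have e5 : Q.card * (16 * η * n) ≤ 192 * C / c * (r₁ ^ κ * r₂ ^ (1 - κ)) * η := by
      calc Q.card * (16 * η * n) = (Q.card * η) * (16 * n) := by ring
        _ ≤ (12 * C / c * (m ^ κ * r₂ ^ (1 - κ))) * (16 * n) := by gcongr
        _ = 192 * C / c * r₂ ^ (1 - κ) * (m ^ κ * n) := by ring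
        _ ≤ 192 * C / c * r₂ ^ (1 - κ) * (r₁ ^ κ * η) := by gcongr
        _ = _ := by ring
    have e4 : 0 ≤ 4 * (r₁ ^ κ * r₂ ^ (1 - κ)) * η := by positivity
    linarith

open Classical in
lemma Reg.vol_ge (R : Reg J μ κ C c) {η : ℝ} (h0 : 0 < η) (P : Finset ℂ)
    (hsep : ∀ x ∈ P, ∀ y ∈ P, x ≠ y → η < dist x y) (hcov : J ⊆ ⋃ x ∈ P, closedBall x η) :
    η / (3 * C) ≤ volume.real (⋃ y ∈ P, closedBall y (2 * η)) := by
  have hC := R.C0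
  have hd : (P : Set ℂ).PairwiseDisjoint (fun x => closedBall x (η / 3)) := by
    intro x hx y hy hxy
    refine closedBall_disjoint_closedBall ?_
    have := hsep x hx y hy hxy
    linarith
  have h2 : volume.real (⋃ x ∈ P, closedBall x (η / 3)) = ∑ x ∈ P, volume.real (closedBall x (η / 3)) :=
    measureReal_biUnion_finset hd (fun _ _ => measurableSet_closedBall) (fun _ _ => measure_closedBall_lt_top.ne)
  have h3 : (P.card : ℝ) * (3 * (η / 3) * (η / 3)) ≤ ∑ x ∈ P, volume.real (closedBall x (η / 3)) := by
    rw [← nsmul_eq_mul]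
    exact Finset.card_nsmul_le_sum _ _ _ fun x hx => volball_ge x (by positivity)
  have h4 : volume.real (⋃ x ∈ P, closedBall x (η / 3)) ≤ volume.real (⋃ y ∈ P, closedBall y (2 * η)) := by
    refine measureReal_mono ?_ ?_
    · exact iUnion₂_mono fun y _ => closedBall_subset_closedBall (by linarith)
    · exact (measure_biUnion_lt_top P.finite_toSet fun y _ => measure_closedBall_lt_top).ne
  have h5 := R.card_ge h0 P hcov
  have h6 : η / (3 * C) ≤ (P.card : ℝ) * (3 * (η / 3) * (η / 3)) := by
    rw [div_le_iff₀ (by positivity)]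
    nlinarith
  linarith

lemma Reg.vol_le (R : Reg J μ κ C c) {η : ℝ} (h0 : 0 < η) (h1 : η ≤ 1) (P : Finset ℂ)
    (hPJ : ∀ x ∈ P, x ∈ J)
    (hsep : ∀ x ∈ P, ∀ y ∈ P, x ≠ y → η < dist x y) :
    volume.real (⋃ y ∈ P, closedBall y (2 * η)) ≤ 24 / c * (2 * η) := by
  have := R.prob
  have hc := R.c0
  have h := R.sep h0 h1 P hPJ hsep univ (fun _ _ => subset_univ _)
  rw [probReal_univ] at h
  have h2 : volume.real (⋃ y ∈ P, closedBall y (2 * η)) ≤ P.card * (4 * (2 * η) * (2 * η)) := by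
    refine (measureReal_biUnion_finset_le _ _).trans ?_
    rw [← nsmul_eq_mul]
    exact Finset.sum_le_card_nsmul _ _ _ fun y _ => volball y (by positivity)
  refine h2.trans ?_
  rw [div_mul_eq_mul_div, le_div_iff₀ hc]
  nlinarith

open Classical in
lemma Reg.overlap (R : Reg J μ κ C c) {η : ℝ} (h0 : 0 < η) (h1 : η ≤ 1) (P : Finset ℂ)
    (hPJ : ∀ x ∈ P, x ∈ J)
    (hsep : ∀ x ∈ P, ∀ y ∈ P, x ≠ y → η < dist x y) (y : ℂ) :
    ({x ∈ (P : Set ℂ) | y ∈ closedBall x (2 * η)}).Finite ∧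
        (({x ∈ (P : Set ℂ) | y ∈ closedBall x (2 * η)}).ncard : ℝ) ≤ 9 * C / c := by
  have hc := R.c0
  let Q := P.filter (fun x => y ∈ closedBall x (2 * η))
  have hQ : {x ∈ (P : Set ℂ) | y ∈ closedBall x (2 * η)} = (Q : Set ℂ) := by
    ext x; simp [Q]
  rw [hQ]
  refine ⟨Q.finite_toSet, ?_⟩
  rw [Set.ncard_coe_finset]
  have h := R.sep h0 h1 Q (fun y hy => hPJ y (Finset.mem_filter.1 hy).1)
        (fun y hy w hw h => hsep y (Finset.mem_filter.1 hy).1 w (Finset.mem_filter.1 hw).1 h)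
        (closedBall y (3 * η)) (by
          intro x hx
          have := (Finset.mem_filter.1 hx).2
          rw [mem_closedBall, dist_comm] at this
          exact closedBall_subset_closedBall' (by linarith))
  have h2 := h.trans (R.ball y (show 0 < 3 * η by positivity))
  rw [le_div_iff₀ hc]
  nlinarith

end SS

namespace SS

variable {J : Set ℂ} {μ : Measure ℂ} {κ C c : ℝ}

lemma line_strip {ℓ : Set ℂ} (h : IsLine ℓ) :
    ∃ u : ℂ, ‖u‖ = 1 ∧ ∃ t : ℝ, ∀ ε : ℝ, 0 ≤ ε → cthickening ε ℓ ⊆ strip u t ε := by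
  obtain ⟨p, v, hv, rfl⟩ := h
  have hv' : ‖v‖ ≠ 0 := norm_ne_zero_iff.2 hv
  let u : ℂ := (‖v‖⁻¹ : ℝ) • (Complex.I * v)
  have hu : ‖u‖ = 1 := by
    simp only [u, norm_smul, norm_mul, Complex.norm_I, one_mul, norm_inv, norm_norm]
    exact inv_mul_cancel₀ hv'
  refine ⟨u, hu, inner ℝ u p, ?_⟩
  intro ε hε y hy
  show |inner ℝ u y - inner ℝ u p| ≤ ε
  refine le_of_forall_gt_imp_ge_of_dense ?_
  intro s hs
  have hy2 := cthickening_subset_thickening' (lt_of_le_of_lt hε hs) hs _ hy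
  obtain ⟨w, ⟨τ, rfl⟩, hw⟩ := mem_thickening_iff.1 hy2
  have h1 : |inner ℝ u y - inner ℝ u (p + τ • v)| ≤ s := ball_sub_strip hu _ s hw.le
  have h2 : inner ℝ u v = 0 := by
    simp only [u, real_inner_smul_left, Complex.inner]
    simp
    right; ring
  rw [inner_add_right, real_inner_smul_right, h2, mul_zero, add_zero] at h1
  exact h1

lemma rect_sub {S : Set ℂ} {r₁ r₂ : ℝ} (h : r₁ ≤ r₂) (hS : IsRect S r₁ r₂) :
    ∃ u z : ℂ, ‖u‖ = 1 ∧ ∃ t : ℝ, S ⊆ closedBall z (2 * r₂) ∩ strip u t r₁ := by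
  obtain ⟨z, w, hw, rfl⟩ := hS
  have hwI : ‖w * Complex.I‖ = 1 := by simp [hw]
  refine ⟨w * Complex.I, z, hwI, inner ℝ (w * Complex.I) z, ?_⟩
  rintro _ ⟨⟨a, b⟩, ⟨⟨ha0, ha⟩, ⟨hb0, hb⟩⟩, rfl⟩
  simp only at ha0 ha hb0 hb ⊢
  constructor
  · rw [mem_closedBall, dist_eq_norm]
    have : z + a • w + b • (w * Complex.I) - z = a • w + b • (w * Complex.I) := by ring
    rw [this]
    refine (norm_add_le _ _).trans ?_
    rw [norm_smul, norm_smul, hw, hwI, Real.norm_of_nonneg ha0, Real.norm_of_nonneg hb0]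
    linarith
  · show |inner ℝ (w * Complex.I) (z + a • w + b • (w * Complex.I)) - inner ℝ (w * Complex.I) z| ≤ r₁
    have h2 : inner ℝ (w * Complex.I) w = 0 := by
      simp only [Complex.inner]
      simp
      ring
    rw [inner_add_right, inner_add_right, real_inner_smul_right, real_inner_smul_right, h2,
      real_inner_self_eq_norm_sq, hwI]
    rw [show ∀ q : ℝ, q + a * 0 + b * 1 ^ 2 - q = b by intro q; ring, abs_of_nonneg hb0]
    exact hb

lemma Reg.main (R : Reg J μ κ C c) : ∃ C', 0 < C' ∧ ∀ η : ℝ, 0 < η → η ≤ 1 →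
    ∃ A, UnrectOneSet κ C' (2 * η) A ∧ A ⊆ cthickening (2 * η) J ∧ cthickening η J ⊆ A := by
  have hc := R.c0
  have hC := R.C0
  have hκ := R.κ0
  have hκ1 : 0 ≤ 1 - κ := by linarith [R.κ1]
  set K1 := 3 * C * (4 + 192 * C / c) with hK1
  have hK10 : 0 < K1 := by positivity
  obtain ⟨x0, hx0⟩ := R.Jne
  obtain ⟨D, hD⟩ := R.Jc.isBounded.subset_closedBall x0
  have hD0 : 0 ≤ D := by
    have := hD hx0
    rwa [mem_closedBall, dist_self] at this
  set R0 := D + 2 with hR0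
  have hR00 : 0 < R0 := by linarith
  obtain ⟨ε, hε0, hεR, hε⟩ : ∃ ε, 0 < ε ∧ ε ≤ R0 ∧ K1 * (ε ^ κ * R0 ^ (1 - κ)) ≤ 1 / 10 := by
    set X := 1 / (10 * K1 * R0 ^ (1 - κ)) with hX
    have hX0 : 0 < X := by positivity
    refine ⟨min R0 (X ^ (1 / κ)), lt_min hR00 (by positivity), min_le_left _ _, ?_⟩
    have h1 : (min R0 (X ^ (1 / κ))) ^ κ ≤ X := by
      calc (min R0 (X ^ (1 / κ))) ^ κ ≤ (X ^ (1 / κ)) ^ κ := by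
            apply Real.rpow_le_rpow (le_min hR00.le (by positivity)) (min_le_right _ _) hκ.le
        _ = X := by rw [← Real.rpow_mul hX0.le, one_div_mul_cancel hκ.ne', Real.rpow_one]
    calc _ ≤ K1 * (X * R0 ^ (1 - κ)) := by gcongr
      _ = 1 / 10 := by
        have : R0 ^ (1 - κ) ≠ 0 := by positivity
        rw [hX]; field_simp
  set C' := 9 * C / c + 6 * C + 24 / c + 2 * K1 + 1 / ε with hC'
  have p1 : 0 < 9 * C / c := by positivity
  have p2 : 0 < 24 / c := by positivity
  have p3 : 0 < 1 / ε := by positivity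
  have hC'0 : 0 < C' := by positivity
  refine ⟨C', hC'0, ?_⟩
  intro η h0 h1
  obtain ⟨P, hPne, hPJ, hsep, hcov⟩ := R.net h0 h1
  set A := ⋃ y ∈ P, closedBall y (2 * η) with hA
  have hvg : η / (3 * C) ≤ volume.real A := R.vol_ge h0 P hsep hcov
  have hvl : volume.real A ≤ 24 / c * (2 * η) := R.vol_le h0 h1 P hPJ hsep
  have hAfin : volume A ≠ ⊤ :=
    (measure_biUnion_lt_top P.finite_toSet fun y _ => measure_closedBall_lt_top).ne
  have hηA : η ≤ 3 * C * volume.real A := by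
    rw [div_le_iff₀ (by positivity)] at hvg; linarith
  have hA0 : 0 ≤ volume.real A := measureReal_nonneg
  have hkey : ∀ (u x : ℂ) (t r₁ r₂ : ℝ), ‖u‖ = 1 → 0 < r₁ → r₁ ≤ r₂ →
      ∀ S ⊆ A ∩ (closedBall x r₂ ∩ strip u t r₁),
      volume.real S ≤ K1 * (r₁ ^ κ * r₂ ^ (1 - κ)) * volume.real A := by
    intro u x t r₁ r₂ hu hr hr2 S hS
    have hr20 : 0 < r₂ := by linarith
    have h := R.key h0 h1 P hPJ hsep u x t r₁ r₂ hu hr hr2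
    refine (measureReal_mono hS (measure_ne_top_of_subset inter_subset_left hAfin)).trans ?_
    refine h.trans ?_
    calc _ ≤ (4 + 192 * C / c) * (r₁ ^ κ * r₂ ^ (1 - κ)) * (3 * C * volume.real A) := by gcongr
      _ = _ := by rw [hK1]; ring
  have hexp : (2 * η) ^ (2 - 1 : ℝ) = 2 * η := by norm_num
  refine ⟨A, ⟨⟨⟨P, by exact_mod_cast hPne, ?_, ?_⟩, ?_, ?_, ?_, ?_⟩, ?_⟩, ?_, ?_⟩
  · simp [hA]
  · intro y
    obtain ⟨a, b⟩ := R.overlap h0 h1 P hPJ hsep y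
    exact ⟨a, by linarith⟩
  · rw [hexp]
    show _ ≤ volume.real A
    rw [inv_mul_le_iff₀ hC'0]
    have : 6 * C ≤ C' := by linarith
    have := mul_le_mul_of_nonneg_right this hA0
    linarith
  · rw [hexp]
    show volume.real A ≤ _
    refine hvl.trans ?_
    gcongr
    linarith
  · intro x r hr
    have h := hkey 1 x (inner ℝ 1 x) r r (by simp) hr le_rfl (A ∩ closedBall x r)
      (inter_subset_inter_right _ (subset_inter subset_rfl (ball_sub_strip (by simp) x r)))
    rw [← Real.rpow_add hr, add_sub_cancel] at h
    refine h.trans ?_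
    show _ ≤ C' * r ^ (1:ℝ) * volume.real A
    gcongr
    linarith
  · intro ℓ hℓ
    obtain ⟨u, hu, t, ht⟩ := line_strip hℓ
    have hinv : C'⁻¹ ≤ ε := by
      rw [inv_le_comm₀ hC'0 hε0, ← one_div]; linarith
    have hAb : A ⊆ closedBall x0 R0 := by
      refine iUnion₂_subset fun y hy => closedBall_subset_closedBall' ?_
      have := hD (hPJ y hy)
      rw [mem_closedBall] at this
      linarith
    have h := hkey u x0 t ε R0 hu hε0 hεR (A ∩ cthickening C'⁻¹ ℓ) (by
      rintro y ⟨hy1, hy2⟩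
      exact ⟨hy1, hAb hy1, strip_mono hinv (ht _ (by positivity) hy2)⟩)
    refine h.trans ?_
    show _ ≤ volume.real A / 10
    nlinarith
  · intro S r₁ r₂ hr hr2 hS
    have hr20 : 0 < r₂ := by linarith
    obtain ⟨u, z, hu, t, hsub⟩ := rect_sub hr2 hS
    have h := hkey u z t r₁ (2 * r₂) hu hr (by linarith) (A ∩ S) (inter_subset_inter_right _ hsub)
    refine h.trans ?_
    show _ ≤ C' * r₁ ^ κ * r₂ ^ (1 - κ) * volume.real A
    rw [Real.mul_rpow (by norm_num) hr20.le]
    have h2 : (2:ℝ) ^ (1 - κ) ≤ 2 := by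
      calc (2:ℝ) ^ (1 - κ) ≤ 2 ^ (1:ℝ) := Real.rpow_le_rpow_of_exponent_le (by norm_num) (by linarith)
        _ = 2 := Real.rpow_one 2
    calc _ ≤ K1 * (r₁ ^ κ * (2 * r₂ ^ (1 - κ))) * volume.real A := by gcongr
      _ = (2 * K1) * r₁ ^ κ * r₂ ^ (1 - κ) * volume.real A := by ring
      _ ≤ _ := by
        gcongr
        linarith [mul_pos (show (0:ℝ) < 6 by norm_num) hC]
  · exact iUnion₂_subset fun y hy => closedBall_subset_cthickening (hPJ y hy) _
  · rw [R.Jc.cthickening_eq_biUnion_closedBall h0.le]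
    refine iUnion₂_subset fun y hy => ?_
    obtain ⟨x, hx, hxy⟩ := mem_iUnion₂.1 (hcov hy)
    rw [mem_closedBall] at hxy
    exact (closedBall_subset_closedBall' (by linarith)).trans (subset_biUnion_of_mem (u := fun y => closedBall y (2 * η)) hx)

end SS

/-- The `δ`-neighborhood of a one-dimensional self-similar set satisfying the Open Set
Condition and not contained in a line is equivalent to a `(κ,C₀,δ)`-unrectifiable
one-set, with constants independent of `δ`. -/
theorem stmt13 (s : ℕ) (T : Fin s → ℂ → ℂ) (lam : Fin s → ℝ)
    (rot : Fin s → ℂ ≃ₗᵢ[ℝ] ℂ) (z : Fin s → ℂ)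
    (hlam : ∀ i, 0 < lam i ∧ lam i < 1)
    (hT : ∀ i x, T i x = lam i • (rot i x) + z i)
    (J : Set ℂ) (hJc : IsCompact J) (hJne : J.Nonempty)
    (hself : J = ⋃ i, T i '' J)
    (hOSC : ∃ Op : Set ℂ, IsOpen Op ∧ Op.Nonempty ∧ (⋃ i, T i '' Op) ⊆ Op ∧
      ∀ i j, i ≠ j → Disjoint (T i '' Op) (T j '' Op))
    (hdim : dimH J = 1) (hline : ¬ Collinear ℝ J) :
    ∃ κ C₀ K : ℝ, 0 < κ ∧ 0 < C₀ ∧ 1 ≤ K ∧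
      ∀ δ : ℝ, 0 < δ → δ ≤ 1 →
        ∃ (A₁ A₂ : Set ℂ) (C₁ C₂ δ₁ δ₂ : ℝ),
          UnrectOneSet κ C₁ δ₁ A₁ ∧ UnrectOneSet κ C₂ δ₂ A₂ ∧
          A₁ ⊆ cthickening δ J ∧ cthickening δ J ⊆ A₂ ∧
          C₁ ≤ K * C₀ ∧ C₂ ≤ K * C₀ ∧
          K⁻¹ * δ ≤ δ₁ ∧ δ₁ ≤ K * δ ∧ K⁻¹ * δ ≤ δ₂ ∧ δ₂ ≤ K * δ := by
  obtain ⟨Op, μ, l, L, S⟩ := SS.exists_sys T lam rot z hlam hT J hJc hJne hself hOSC hdim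
  obtain ⟨κ, C, c, R⟩ := S.reg hline
  obtain ⟨C', hC', h⟩ := R.main
  refine ⟨κ, C', 2, R.κ0, hC', by norm_num, ?_⟩
  intro δ hδ hδ1
  obtain ⟨A₁, a1, a2, -⟩ := h (δ / 2) (by linarith) (by linarith)
  obtain ⟨A₂, b1, -, b2⟩ := h δ hδ hδ1
  rw [mul_div_cancel₀ δ (two_ne_zero)] at a1 a2
  refine ⟨A₁, A₂, C', C', δ, 2 * δ, a1, b1, a2, b2, ?_, ?_, ?_, ?_, ?_, ?_⟩ <;> linarith
end

section
/- Let 𝒥 ⊆ ℝ² be a self-similar set satisfying the Open Set Condition with dim_H(𝒥) = α, where 0 < α ≤ 1. Then there exists a constant C₀ ≥ 1, independent of δ, r, and the choice of ball, such that for all 0 < δ ≤ diam(𝒥) and every ball B = B(x,r) with r ≥ δ, the two-dimensional Lebesgue measure satisfies |𝒥^δ ∩ B| ≤ C₀ r^α |𝒥^δ|. -/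
open MeasureTheory Metric Set

def IsSim15 (f : ℂ → ℂ) (m : ℝ) : Prop :=
  0 < m ∧ ∃ (R : ℂ ≃ₗᵢ[ℝ] ℂ) (c : ℂ), ∀ x, f x = m • R x + c

lemma IsSim15.inj {f : ℂ → ℂ} {m : ℝ} (h : IsSim15 f m) : Function.Injective f := by
  obtain ⟨hm, R, c, hf⟩ := h
  intro x y hxy
  rw [hf, hf] at hxy
  have h1 := add_right_cancel hxy
  exact R.injective (smul_right_injective ℂ hm.ne' h1)

lemma IsSim15.dist {f : ℂ → ℂ} {m : ℝ} (h : IsSim15 f m) (x y : ℂ) :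
    dist (f x) (f y) = m * dist x y := by
  obtain ⟨hm, R, c, hf⟩ := h
  rw [hf, hf, dist_add_right, dist_smul₀, R.dist_map, Real.norm_of_nonneg hm.le]

lemma IsSim15.surj {f : ℂ → ℂ} {m : ℝ} (h : IsSim15 f m) : Function.Surjective f := by
  obtain ⟨hm, R, c, hf⟩ := h
  intro y
  refine ⟨R.symm (m⁻¹ • (y - c)), ?_⟩
  rw [hf, R.apply_symm_apply, smul_inv_smul₀ hm.ne', sub_add_cancel]

lemma IsSim15.comp {f g : ℂ → ℂ} {m n : ℝ} (h : IsSim15 f m) (h' : IsSim15 g n) :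
    IsSim15 (f ∘ g) (m * n) := by
  obtain ⟨hm, R, c, hf⟩ := h
  obtain ⟨hn, R', c', hg⟩ := h'
  refine ⟨mul_pos hm hn, R'.trans R, m • R c' + c, fun x => ?_⟩
  simp only [Function.comp, hf, hg, map_add, LinearIsometryEquiv.map_smul, smul_add, smul_smul,
    LinearIsometryEquiv.trans_apply]
  ring

open scoped Pointwise in
lemma IsSim15.vol {f : ℂ → ℂ} {m : ℝ} (h : IsSim15 f m) (A : Set ℂ) :
    volume (f '' A) = ENNReal.ofReal (m ^ 2) * volume A := by
  obtain ⟨hm, R, c, hf⟩ := h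
  have : f '' A = (fun x => x + c) '' (m • (R '' A)) := by
    rw [← image_smul, image_image, image_image]
    exact image_congr (fun x _ => hf x)
  rw [this, image_add_right, measure_preimage_add_right, Measure.addHaar_smul,
    Complex.finrank_real_complex, abs_of_nonneg (by positivity)]
  congr 1
  have := R.symm.measurePreserving.measure_preimage_equiv (f := R.symm.toMeasurableEquiv) A
  rw [← this]
  congr 1
  ext x
  constructor
  · rintro ⟨y, hy, rfl⟩
    simpa using hy
  · intro hx
    exact ⟨R.symm x, hx, by simp⟩

lemma IsSim15.cthick {f : ℂ → ℂ} {m : ℝ} (h : IsSim15 f m) {J : Set ℂ} (hJ : IsCompact J)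
    {t : ℝ} (ht : 0 ≤ t) :
    f '' (cthickening (t / m) J) = cthickening t (f '' J) := by
  have hm := h.1
  have hc : Continuous f := by
    obtain ⟨hm, R, c, hf⟩ := h
    have : f = fun x => m • R x + c := funext hf
    rw [this]; fun_prop
  rw [hJ.cthickening_eq_biUnion_closedBall (by positivity),
    (hJ.image hc).cthickening_eq_biUnion_closedBall ht]
  ext y
  obtain ⟨y, rfl⟩ := h.surj y
  rw [h.inj.mem_set_image]
  simp only [mem_iUnion, mem_closedBall, exists_prop, exists_mem_image, h.dist]
  simp only [le_div_iff₀ hm, mul_comm]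

structure Fam15 {s : ℕ} (lam : Fin s → ℝ) (J Op : Set ℂ) (a r : ℝ) (ι : Type) [Fintype ι]
    (S : ι → ℂ → ℂ) (m : ι → ℝ) : Prop where
  sim : ∀ k, IsSim15 (S k) (m k)
  lo : ∀ k, a * r ≤ m k
  hi : ∀ k, m k ≤ r
  cov : J = ⋃ k, S k '' J
  disj : ∀ k l, k ≠ l → Disjoint (S k '' Op) (S l '' Op)
  ge : ∀ β : ℝ, 1 ≤ ∑ i, lam i ^ β → 1 ≤ ∑ k, m k ^ β
  le : ∀ β : ℝ, ∑ i, lam i ^ β ≤ 1 → ∑ k, m k ^ β ≤ 1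

def Good15 {s : ℕ} (lam : Fin s → ℝ) (J Op : Set ℂ) (a r : ℝ) : Prop :=
  ∃ (ι : Type) (_ : Fintype ι) (S : ι → ℂ → ℂ) (m : ι → ℝ), Fam15 lam J Op a r ι S m

section
variable {s : ℕ} {T : Fin s → ℂ → ℂ} {lam : Fin s → ℝ} {J Op : Set ℂ} {a b r : ℝ}

lemma good15_one (ha : a ≤ 1) : Good15 lam J Op a 1 := by
  refine ⟨Unit, inferInstance, fun _ => id, fun _ => 1, ?_, ?_, ?_, ?_, ?_, ?_, ?_⟩
  · intro k
    exact ⟨one_pos, LinearIsometryEquiv.refl ℝ ℂ, 0, by simp⟩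
  · simpa using ha
  · simp
  · simp only [image_id, iUnion_const]
  · intro k l h
    exact absurd (Subsingleton.elim k l) h
  · simp
  · simp

lemma good15_step (hT : ∀ i, IsSim15 (T i) (lam i)) (hself : J = ⋃ i, T i '' J)
    (hsub : (⋃ i, T i '' Op) ⊆ Op) (hd : ∀ i j, i ≠ j → Disjoint (T i '' Op) (T j '' Op))
    (ha : 0 < a) (hal : ∀ i, a ≤ lam i) (hbl : ∀ i, lam i ≤ b)
    {r r' : ℝ} (hr' : 0 < r') (hrr : r' ≤ r) (hbr : b * r ≤ r')
    (h : Good15 lam J Op a r) : Good15 lam J Op a r' := by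
  classical
  obtain ⟨ι, _, S, m, F⟩ := h
  have hpos : ∀ k, 0 < m k := fun k => (F.sim k).1
  have hTO : ∀ k i, (S k ∘ T i) '' Op ⊆ S k '' Op := by
    intro k i
    rw [image_comp]
    exact image_mono ((subset_iUnion (fun i => T i '' Op) i).trans hsub)
  refine ⟨{k // m k ≤ r'} ⊕ ({k // ¬ m k ≤ r'} × Fin s), inferInstance,
    Sum.elim (fun k => S k) (fun p => S p.1 ∘ T p.2),
    Sum.elim (fun k => m k) (fun p => m p.1 * lam p.2), ?_, ?_, ?_, ?_, ?_, ?_, ?_⟩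
  · rintro (k | ⟨k, i⟩)
    · exact F.sim k
    · exact (F.sim k).comp (hT i)
  · rintro (k | ⟨k, i⟩)
    · exact le_trans (by gcongr) (F.lo k)
    · have := k.2
      push Not at this
      simp only [Sum.elim_inr]
      rw [mul_comm]
      exact mul_le_mul this.le (hal i) ha.le (hpos _).le
  · rintro (k | ⟨k, i⟩)
    · exact k.2
    · simp only [Sum.elim_inr]
      refine le_trans ?_ hbr
      rw [mul_comm]
      exact mul_le_mul (hbl i) (F.hi k) (hpos _).le ((hT i).1.le.trans (hbl i))
  · have h1 : ∀ k, S k '' J = ⋃ i, (S k ∘ T i) '' J := by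
      intro k
      conv_lhs => rw [hself, image_iUnion]
      simp only [image_comp]
    apply Subset.antisymm
    · intro x hx
      rw [F.cov, mem_iUnion] at hx
      obtain ⟨k, hk⟩ := hx
      rw [mem_iUnion]
      by_cases hkr : m k ≤ r'
      · exact ⟨Sum.inl ⟨k, hkr⟩, hk⟩
      · rw [h1, mem_iUnion] at hk
        obtain ⟨i, hi⟩ := hk
        exact ⟨Sum.inr (⟨k, hkr⟩, i), hi⟩
    · apply iUnion_subset
      have h2 : ∀ k, S k '' J ⊆ J := fun k => by
        conv_rhs => rw [F.cov]
        exact subset_iUnion (fun k => S k '' J) k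
      rintro (k | ⟨k, i⟩)
      · exact h2 k
      · refine Subset.trans ?_ (h2 k)
        rw [h1 k]
        exact subset_iUnion (fun i => (S k ∘ T i) '' J) i
  · rintro (k | ⟨k, i⟩) (l | ⟨l, j⟩) hne
    · exact F.disj _ _ (fun h => hne (by rw [Subtype.ext h]))
    · refine (F.disj k l ?_).mono_right (hTO _ _)
      intro h
      exact l.2 (h ▸ k.2)
    · refine (F.disj k l ?_).mono_left (hTO _ _)
      intro h
      exact k.2 (h ▸ l.2)
    · by_cases hkl : k = l
      · subst hkl
        simp only [Sum.elim_inr]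
        rw [image_comp, image_comp, disjoint_image_iff (F.sim _).inj]
        exact hd _ _ (fun h => hne (by rw [h]))
      · exact (F.disj k l (fun h => hkl (Subtype.ext h))).mono (hTO _ _) (hTO _ _)
  · intro β hβ
    refine (F.ge β hβ).trans ?_
    rw [Fintype.sum_sum_type, Fintype.sum_prod_type,
      ← Fintype.sum_subtype_add_sum_subtype (fun k => m k ≤ r')]
    simp only [Sum.elim_inl, Sum.elim_inr]
    gcongr with k
    simp_rw [Real.mul_rpow (hpos k).le (hT _).1.le]
    rw [← Finset.mul_sum]
    exact le_mul_of_one_le_right (Real.rpow_nonneg (hpos _).le _) hβ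
  · intro β hβ
    refine le_trans ?_ (F.le β hβ)
    rw [Fintype.sum_sum_type, Fintype.sum_prod_type,
      ← Fintype.sum_subtype_add_sum_subtype (fun k => m k ≤ r')]
    simp only [Sum.elim_inl, Sum.elim_inr]
    gcongr with k
    simp_rw [Real.mul_rpow (hpos k).le (hT _).1.le]
    rw [← Finset.mul_sum]
    exact mul_le_of_le_one_right (Real.rpow_nonneg (hpos _).le _) hβ

lemma good15 (hT : ∀ i, IsSim15 (T i) (lam i)) (hself : J = ⋃ i, T i '' J)
    (hsub : (⋃ i, T i '' Op) ⊆ Op) (hd : ∀ i j, i ≠ j → Disjoint (T i '' Op) (T j '' Op))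
    (ha : 0 < a) (ha1 : a ≤ 1) (hal : ∀ i, a ≤ lam i) (hbl : ∀ i, lam i ≤ b)
    (hb : 0 < b) (hb1 : b < 1)
    {r : ℝ} (hr : 0 < r) (hr1 : r ≤ 1) : Good15 lam J Op a r := by
  obtain ⟨n, hn⟩ := exists_pow_lt_of_lt_one hr hb1
  replace hn := hn.le
  induction n generalizing r with
  | zero =>
    have : r = 1 := le_antisymm hr1 (by simpa using hn)
    rw [this]; exact good15_one ha1
  | succ n ih =>
    refine good15_step hT hself hsub hd ha hal hbl (r := min 1 (r / b)) hr ?_ ?_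
      (ih (by positivity) (min_le_left _ _) ?_)
    · refine le_min hr1 ?_
      rw [le_div_iff₀ hb]; nlinarith
    · calc b * min 1 (r / b) ≤ b * (r / b) := by gcongr; exact min_le_right _ _
        _ = r := by field_simp
    · refine le_min (pow_le_one₀ hb.le hb1.le) ?_
      rw [le_div_iff₀ hb, ← pow_succ]; exact hn

lemma sum15 {α : ℝ} (hlam : ∀ i, 0 < lam i) (hJc : IsCompact J)
    (hgood : ∀ r, 0 < r → r ≤ 1 → Good15 lam J Op a r)
    (hα0 : 0 < α) (hdim : dimH J = ENNReal.ofReal α) : 1 ≤ ∑ i, lam i ^ α := by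
  by_contra! hlt
  have hcont : Continuous (fun β : ℝ => ∑ i, lam i ^ β) := by
    apply continuous_finsetSum
    intro i _
    exact Real.continuous_const_rpow (hlam i).ne'
  obtain ⟨β, hβα, hβ0, hβ⟩ : ∃ β, β < α ∧ 0 < β ∧ ∑ i, lam i ^ β < 1 := by
    have h1 : ∀ᶠ β in nhdsWithin α (Iio α), ∑ i, lam i ^ β < 1 :=
      (hcont.tendsto α).mono_left nhdsWithin_le_nhds |>.eventually (gt_mem_nhds hlt)
    have h2 : ∀ᶠ β in nhdsWithin α (Iio α), 0 < β :=
      (lt_mem_nhds hα0).filter_mono nhdsWithin_le_nhds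
    obtain ⟨β, h⟩ := (h1.and (h2.and self_mem_nhdsWithin)).exists
    exact ⟨β, h.2.2, h.2.1, h.1⟩
  choose ι hι S m F using fun n : ℕ => hgood (1 / ((n : ℝ) + 1)) (by positivity)
    (by rw [div_le_one (by positivity)]; linarith [(Nat.cast_nonneg n : (0:ℝ) ≤ n)])
  set D := Metric.diam J with hD
  have hdiam : ∀ n k, ediam (S n k '' J) ≤ ENNReal.ofReal (m n k * D) := by
    intro n k
    refine ediam_le ?_
    rintro _ ⟨x, hx, rfl⟩ _ ⟨y, hy, rfl⟩
    rw [edist_dist, ((F n).sim k).dist]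
    apply ENNReal.ofReal_le_ofReal
    have := ((F n).sim k).1
    gcongr
    exact dist_le_diam_of_mem hJc.isBounded hx hy
  have hmeas := Measure.hausdorffMeasure_le_liminf_sum (X := ℂ) β J (l := Filter.atTop)
    (fun n : ℕ => ENNReal.ofReal (1 / ((n : ℝ) + 1) * D)) (by
      rw [← ENNReal.ofReal_zero]
      apply ENNReal.tendsto_ofReal
      simpa using (tendsto_one_div_add_atTop_nhds_zero_nat (𝕜 := ℝ)).mul_const D)
    (fun n k => S n k '' J)
    (Filter.Eventually.of_forall fun n k => (hdiam n k).trans (by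
      apply ENNReal.ofReal_le_ofReal
      exact mul_le_mul_of_nonneg_right ((F n).hi k) diam_nonneg))
    (Filter.Eventually.of_forall fun n => (F n).cov.subset)
  have hfin : μH[β] J ≤ ENNReal.ofReal (D ^ β) := by
    refine hmeas.trans ?_
    refine Filter.liminf_le_of_le (by isBoundedDefault) ?_
    intro c hc
    obtain ⟨n, hn⟩ := hc.exists
    refine hn.trans ?_
    calc ∑ k, ediam (S n k '' J) ^ β ≤ ∑ k, ENNReal.ofReal (m n k ^ β * D ^ β) := by
          gcongr with k
          rw [← Real.mul_rpow ((F n).sim k).1.le diam_nonneg,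
            ← ENNReal.ofReal_rpow_of_nonneg (mul_nonneg ((F n).sim k).1.le diam_nonneg) hβ0.le]
          exact ENNReal.rpow_le_rpow (hdiam n k) hβ0.le
      _ = ENNReal.ofReal (∑ k, m n k ^ β * D ^ β) := by
          rw [ENNReal.ofReal_sum_of_nonneg]
          intro k _
          have := ((F n).sim k).1
          have : 0 ≤ D := diam_nonneg
          positivity
      _ ≤ _ := by
          apply ENNReal.ofReal_le_ofReal
          rw [← Finset.sum_mul]
          exact mul_le_of_le_one_left (Real.rpow_nonneg diam_nonneg _) ((F n).le β hβ.le)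
  have := dimH_le_of_hausdorffMeasure_ne_top (d := ⟨β, hβ0.le⟩) (s := J)
    (ne_top_of_le_ne_top ENNReal.ofReal_ne_top hfin)
  rw [hdim] at this
  have h3 : ENNReal.ofReal α ≤ ENNReal.ofReal β := by
    rw [ENNReal.ofReal_eq_coe_nnreal hβ0.le]; exact this
  exact absurd ((ENNReal.ofReal_le_ofReal_iff hβ0.le).1 h3) (not_le.2 hβα)

open scoped Classical in
lemma count15 (hJc : IsCompact J) (hO : IsOpen Op) (hne : Op.Nonempty) (ha : 0 < a) :
    ∃ M : ℕ, 0 < M ∧ ∀ (r : ℝ) (ι : Type) (_ : Fintype ι) (S : ι → ℂ → ℂ) (m : ι → ℝ), 0 < r →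
      Fam15 lam J Op a r ι S m → ∀ (y : ℂ),
      (Finset.univ.filter (fun k => ∃ p ∈ S k '' J, dist p y ≤ 2 * r)).card ≤ M := by
  obtain ⟨q, hq⟩ := hne
  obtain ⟨ρ, hρ, hball⟩ := nhds_basis_closedBall.mem_iff.1 (hO.mem_nhds hq)
  obtain ⟨K, hK⟩ := hJc.isBounded.subset_closedBall q
  set K' := max K 0
  have hK' : ∀ p ∈ J, dist p q ≤ K' := fun p hp => (hK hp).trans (le_max_left _ _)
  have hK0 : 0 ≤ K' := le_max_right _ _
  set R := 2 + K' + ρ with hR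
  refine ⟨⌊(R / (a * ρ)) ^ 2⌋₊ + 1, by omega, ?_⟩
  intro r ι _ S m hr F y
  set A := Finset.univ.filter (fun k => ∃ p ∈ S k '' J, dist p y ≤ 2 * r) with hA
  have hincl : ∀ k ∈ A, closedBall (S k q) (a * r * ρ) ⊆ closedBall y (R * r) := by
    intro k hk
    obtain ⟨_, ⟨p, hp, rfl⟩, hpy⟩ := (Finset.mem_filter.1 hk).2
    apply closedBall_subset_closedBall'
    have h1 : dist (S k q) y ≤ dist (S k p) (S k q) + dist (S k p) y := by
      rw [dist_comm (S k p) (S k q)]; exact dist_triangle _ _ _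
    rw [(F.sim k).dist] at h1
    have h2 : m k * dist p q ≤ r * K' := 
      mul_le_mul (F.hi k) (hK' p hp) dist_nonneg hr.le
    have h3 : a * r * ρ ≤ r * ρ := by
      gcongr; exact (F.lo k).trans (F.hi k)
    rw [hR]; nlinarith
  have hsubO : ∀ k, closedBall (S k q) (a * r * ρ) ⊆ S k '' Op := by
    intro k w hw
    obtain ⟨w, rfl⟩ := (F.sim k).surj w
    refine mem_image_of_mem _ (hball ?_)
    rw [mem_closedBall, (F.sim k).dist] at hw
    rw [mem_closedBall]
    have h1 : m k * dist w q ≤ m k * ρ := hw.trans (by gcongr; exact F.lo k)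
    exact le_of_mul_le_mul_left h1 (F.sim k).1
  have hvol : ∑ k ∈ A, volume (closedBall (S k q) (a * r * ρ)) ≤ volume (closedBall y (R * r)) := by
    rw [← measure_biUnion_finset (fun k _ l _ hkl => (F.disj k l hkl).mono (hsubO k) (hsubO l))
      (fun k _ => measurableSet_closedBall)]
    exact measure_mono (iUnion₂_subset hincl)
  have hRp : 0 < R := by positivity
  simp only [Complex.volume_closedBall, Finset.sum_const, nsmul_eq_mul] at hvol
  have hreal : (A.card : ℝ) * (a * r * ρ) ^ 2 ≤ (R * r) ^ 2 := by
    rw [← mul_assoc] at hvol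
    have h1 := (ENNReal.mul_le_mul_iff_left (by simp [NNReal.pi_ne_zero]) ENNReal.coe_ne_top).1 hvol
    rw [← ENNReal.ofReal_pow (by positivity), ← ENNReal.ofReal_pow (by positivity),
      ← ENNReal.ofReal_natCast, ← ENNReal.ofReal_mul (by positivity),
      ENNReal.ofReal_le_ofReal_iff (by positivity)] at h1
    exact h1
  have h4 : (A.card : ℝ) ≤ (R / (a * ρ)) ^ 2 := by
    rw [div_pow, le_div_iff₀ (by positivity)]
    have : (A.card : ℝ) * (a * ρ) ^ 2 * r ^ 2 ≤ R ^ 2 * r ^ 2 := by nlinarith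
    exact le_of_mul_le_mul_right this (by positivity)
  exact (Nat.le_floor h4).trans (Nat.le_succ _)

open scoped Classical in
lemma overlap15 {ι : Type} [Fintype ι] (A : ι → Set ℂ) (B : Set ℂ) (M : ℕ)
    (hA : ∀ k, MeasurableSet (A k)) (hAB : ∀ k, A k ⊆ B)
    (h : ∀ y, (Finset.univ.filter (fun k => y ∈ A k)).card ≤ M) :
    ∑ k, volume (A k) ≤ M * volume B := by
  calc ∑ k, volume (A k) = ∑ k, ∫⁻ y, (A k).indicator 1 y := by
        simp_rw [lintegral_indicator_one (hA _)]
    _ = ∫⁻ y, ∑ k, (A k).indicator 1 y := by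
        rw [lintegral_finsetSum]
        intro k _
        exact measurable_one.indicator (hA k)
    _ ≤ ∫⁻ y, B.indicator (fun _ => (M : ENNReal)) y := by
        apply lintegral_mono
        intro y
        by_cases hy : y ∈ B
        · simp only [indicator_of_mem hy]
          simp only [indicator_apply, Pi.one_apply, Finset.sum_boole]
          exact_mod_cast h y
        · have : ∀ k, y ∉ A k := fun k hk => hy (hAB k hk)
          simp [this]
    _ ≤ _ := lintegral_indicator_const_le _ _

lemma vol15 {ι : Type} [Fintype ι] {S : ι → ℂ → ℂ} {m : ι → ℝ} (hJc : IsCompact J)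
    (F : Fam15 lam J Op a r ι S m) {δ : ℝ} (hδ : 0 < δ) (k : ι) :
    volume (cthickening δ (S k '' J)) = ENNReal.ofReal (m k ^ 2) * volume (cthickening (δ / m k) J) := by
  rw [← (F.sim k).cthick hJc hδ.le, (F.sim k).vol]

lemma img15 {ι : Type} [Fintype ι] {S : ι → ℂ → ℂ} {m : ι → ℝ} (hJc : IsCompact J)
    (F : Fam15 lam J Op a r ι S m) (k : ι) : IsCompact (S k '' J) := by
  obtain ⟨hm, R, c, hf⟩ := F.sim k
  have : S k = fun x => m k • R x + c := funext hf
  rw [this]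
  exact hJc.image (by fun_prop)

lemma lower15 {α : ℝ} {M : ℕ} {ι : Type} [hι : Fintype ι] {S : ι → ℂ → ℂ} {m : ι → ℝ}
    (hJc : IsCompact J)
    (hα : 0 < α) (ha : 0 < a) (hr : 0 < r) (F : Fam15 lam J Op a r ι S m)
    (hsum : 1 ≤ ∑ i, lam i ^ α)
    (hM : ∀ (y : ℂ), ((open scoped Classical in
      Finset.univ.filter (fun k => ∃ p ∈ S k '' J, dist p y ≤ 2 * r))).card ≤ M)
    {δ : ℝ} (hδ : 0 < δ) (hδr : δ ≤ r) :
    (a * r) ^ 2 * (volume (cthickening (δ / r) J)).toReal ≤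
      r ^ α * (M * (volume (cthickening δ J)).toReal) := by
  classical
  have h1 := overlap15 (fun k => cthickening δ (S k '' J)) (cthickening δ J) M
    (fun k => isClosed_cthickening.measurableSet)
    (fun k => cthickening_subset_of_subset δ (by
      conv_rhs => rw [F.cov]
      exact subset_iUnion (fun k => S k '' J) k))
    (by
      intro y
      refine le_trans (Finset.card_le_card ?_) (hM y)
      intro k hk
      simp only [Finset.mem_filter, Finset.mem_univ, true_and] at hk ⊢
      rw [(img15 hJc F k).cthickening_eq_biUnion_closedBall hδ.le] at hk
      simp only [mem_iUnion, exists_prop] at hk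
      obtain ⟨p, hp, hk⟩ := hk
      refine ⟨p, hp, ?_⟩
      rw [dist_comm]
      exact (mem_closedBall.1 hk).trans (by linarith))
  have hfin : ∀ t, volume (cthickening t J) ≠ ⊤ := fun t =>
    (hJc.isBounded.cthickening).measure_lt_top.ne
  have h2 : (Fintype.card ι : ENNReal) * (ENNReal.ofReal ((a * r) ^ 2) *
      volume (cthickening (δ / r) J)) ≤ M * volume (cthickening δ J) := by
    refine le_trans ?_ h1
    rw [← nsmul_eq_mul, ← Finset.card_univ, ← Finset.sum_const]
    refine Finset.sum_le_sum fun k _ => ?_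
    rw [vol15 hJc F hδ k]
    have := (F.sim k).1
    have h3 := F.lo k
    have h4 := F.hi k
    gcongr
    exact cthickening_mono (by gcongr) J
  have h3 := ENNReal.toReal_mono (ENNReal.mul_ne_top (ENNReal.natCast_ne_top M) (hfin δ)) h2
  simp only [ENNReal.toReal_mul, ENNReal.toReal_natCast] at h3
  rw [ENNReal.toReal_ofReal (by positivity)] at h3
  have h4 : 1 ≤ (Fintype.card ι : ℝ) * r ^ α := by
    refine (F.ge α hsum).trans ?_
    rw [← nsmul_eq_mul, ← Finset.card_univ, ← Finset.sum_const]
    refine Finset.sum_le_sum fun k _ => ?_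
    exact Real.rpow_le_rpow (F.sim k).1.le (F.hi k) hα.le
  set V := (volume (cthickening (δ / r) J)).toReal
  have hV : 0 ≤ (a * r) ^ 2 * V := by positivity
  calc (a * r) ^ 2 * V ≤ ((Fintype.card ι : ℝ) * r ^ α) * ((a * r) ^ 2 * V) :=
        le_mul_of_one_le_left hV h4
    _ = r ^ α * ((Fintype.card ι : ℝ) * ((a * r) ^ 2 * V)) := by ring
    _ ≤ _ := by gcongr

lemma upper15 {M : ℕ} {ι : Type} [hι : Fintype ι] {S : ι → ℂ → ℂ} {m : ι → ℝ}
    (hJc : IsCompact J) {r₁ : ℝ}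
    (ha : 0 < a) (hr : 0 < r) (hr₁ : a * r₁ = r) (hrr : r ≤ r₁) (F : Fam15 lam J Op a r₁ ι S m)
    (hM : ∀ (y : ℂ), ((open scoped Classical in
      Finset.univ.filter (fun k => ∃ p ∈ S k '' J, dist p y ≤ 2 * r₁))).card ≤ M)
    {δ : ℝ} (hδ : 0 < δ) (hδr : δ ≤ r) (x : ℂ) :
    (volume (cthickening δ J ∩ closedBall x r)).toReal ≤
      M * (r₁ ^ 2 * (volume (cthickening (δ / r) J)).toReal) := by
  classical
  have hfin : ∀ t, volume (cthickening t J) ≠ ⊤ := fun t =>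
    (hJc.isBounded.cthickening).measure_lt_top.ne
  set A := Finset.univ.filter (fun k => ∃ p ∈ S k '' J, dist p x ≤ 2 * r₁) with hA
  have h1 : cthickening δ J ∩ closedBall x r ⊆ ⋃ k ∈ A, cthickening δ (S k '' J) := by
    rintro y ⟨hy, hyx⟩
    rw [hJc.cthickening_eq_biUnion_closedBall hδ.le] at hy
    simp only [mem_iUnion, exists_prop] at hy
    obtain ⟨p, hp, hyp⟩ := hy
    rw [F.cov, mem_iUnion] at hp
    obtain ⟨k, hk⟩ := hp
    rw [mem_closedBall] at hyx hyp
    simp only [mem_iUnion, exists_prop]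
    refine ⟨k, ?_, mem_cthickening_of_dist_le y p δ _ hk hyp⟩
    rw [hA, Finset.mem_filter]
    refine ⟨Finset.mem_univ _, p, hk, ?_⟩
    rw [dist_comm] at hyp
    linarith [dist_triangle p y x]
  have h2 : volume (cthickening δ J ∩ closedBall x r) ≤
      (M : ENNReal) * (ENNReal.ofReal (r₁ ^ 2) * volume (cthickening (δ / r) J)) := by
    calc _ ≤ ∑ k ∈ A, volume (cthickening δ (S k '' J)) :=
          (measure_mono h1).trans (measure_biUnion_finset_le _ _)
      _ ≤ ∑ k ∈ A, (ENNReal.ofReal (r₁ ^ 2) * volume (cthickening (δ / r) J)) := by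
          refine Finset.sum_le_sum fun k _ => ?_
          rw [vol15 hJc F hδ k]
          have := (F.sim k).1
          have h3 := F.lo k
          rw [hr₁] at h3
          have h4 := F.hi k
          gcongr
          exact cthickening_mono (by gcongr) J
      _ ≤ _ := by
          rw [Finset.sum_const, nsmul_eq_mul]
          gcongr
          exact hM x
  have h3 := ENNReal.toReal_mono (ENNReal.mul_ne_top (ENNReal.natCast_ne_top M)
    (ENNReal.mul_ne_top ENNReal.ofReal_ne_top (hfin _))) h2
  simp only [ENNReal.toReal_mul, ENNReal.toReal_natCast] at h3
  rwa [ENNReal.toReal_ofReal (by positivity)] at h3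

end



/-- For a self-similar set `𝒥` of Hausdorff dimension `α` satisfying the Open Set
Condition, and any ball `B = B(x,r)` with `r ≥ δ`, `|𝒥^δ ∩ B| ≤ C₀ r^α |𝒥^δ|`. -/
theorem stmt15 (s : ℕ) (T : Fin s → ℂ → ℂ) (lam : Fin s → ℝ)
    (rot : Fin s → ℂ ≃ₗᵢ[ℝ] ℂ) (z : Fin s → ℂ)
    (hlam : ∀ i, 0 < lam i ∧ lam i < 1)
    (hT : ∀ i x, T i x = lam i • (rot i x) + z i)
    (J : Set ℂ) (hJc : IsCompact J) (hJne : J.Nonempty)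
    (hself : J = ⋃ i, T i '' J)
    (hOSC : ∃ Op : Set ℂ, IsOpen Op ∧ Op.Nonempty ∧ (⋃ i, T i '' Op) ⊆ Op ∧
      ∀ i j, i ≠ j → Disjoint (T i '' Op) (T j '' Op))
    (α : ℝ) (hα0 : 0 < α) (hα1 : α ≤ 1) (hdim : dimH J = ENNReal.ofReal α) :
    ∃ C₀ : ℝ, 1 ≤ C₀ ∧ ∀ (δ r : ℝ) (x : ℂ), 0 < δ → δ ≤ Metric.diam J → δ ≤ r →
      (volume (cthickening δ J ∩ closedBall x r)).toReal ≤
        C₀ * r ^ α * (volume (cthickening δ J)).toReal := by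
  classical
  obtain ⟨Op, hO, hOne, hsub, hd⟩ := hOSC
  have hsim : ∀ i, IsSim15 (T i) (lam i) := fun i => ⟨(hlam i).1, rot i, z i, hT i⟩
  have : Nonempty (Fin s) := by
    obtain ⟨x, hx⟩ := hJne
    rw [hself, mem_iUnion] at hx
    exact ⟨hx.choose⟩
  obtain ⟨i₀, hi₀⟩ := Finite.exists_min lam
  obtain ⟨i₁, hi₁⟩ := Finite.exists_max lam
  set a := lam i₀
  have ha : 0 < a := (hlam i₀).1
  have ha1 : a < 1 := (hlam i₀).2
  have hgood : ∀ r, 0 < r → r ≤ 1 → Good15 lam J Op a r := fun r h0 h1 =>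
    good15 hsim hself hsub hd ha ha1.le hi₀ hi₁ (hlam i₁).1 (hlam i₁).2 h0 h1
  have hsum := sum15 (fun i => (hlam i).1) hJc hgood hα0 hdim
  obtain ⟨M, hM0, hM⟩ := count15 (lam := lam) hJc hO hOne ha
  have hM1 : (1 : ℝ) ≤ M := by exact_mod_cast hM0
  refine ⟨1 + (a ^ α)⁻¹ + M * M / a ^ 4, ?_, ?_⟩
  · have : 0 < (a ^ α)⁻¹ := by positivity
    have : 0 ≤ M * M / a ^ 4 := by positivity
    linarith
  intro δ r x hδ _ hδr
  have hr : 0 < r := hδ.trans_le hδr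
  set V := (volume (cthickening δ J)).toReal with hV
  have hV0 : 0 ≤ V := ENNReal.toReal_nonneg
  have hra : 0 < r ^ α := by positivity
  by_cases har : a ≤ r
  · have h1 : (volume (cthickening δ J ∩ closedBall x r)).toReal ≤ V :=
      ENNReal.toReal_mono (hJc.isBounded.cthickening).measure_lt_top.ne
        (measure_mono inter_subset_left)
    have h2 : 1 ≤ (a ^ α)⁻¹ * r ^ α := by
      rw [inv_mul_eq_div, le_div_iff₀ (by positivity), one_mul]
      gcongr
    have h3 : (0:ℝ) ≤ M * M / a ^ 4 * r ^ α := by positivity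
    have h4 : 1 ≤ (1 + (a ^ α)⁻¹ + M * M / a ^ 4) * r ^ α := by nlinarith
    exact h1.trans (le_mul_of_one_le_left hV0 h4)
  · push Not at har
    obtain ⟨ι, _, S, m, F⟩ := hgood r hr (har.le.trans ha1.le)
    have hr1 : a * (r / a) = r := by field_simp
    obtain ⟨ι', _, S', m', F'⟩ := hgood (r / a) (by positivity) (by
      rw [div_le_one ha]; exact har.le)
    have hrr : r ≤ r / a := by
      rw [le_div_iff₀ ha]; nlinarith
    have h1 := lower15 hJc hα0 ha hr F hsum (hM r ι _ S m hr F) hδ hδr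
    have h2 := upper15 hJc ha hr hr1 hrr F' (hM (r / a) ι' _ S' m' (by positivity) F') hδ hδr x
    set W := (volume (cthickening (δ / r) J)).toReal
    calc _ ≤ _ := h2
      _ = M / a ^ 4 * ((a * r) ^ 2 * W) := by field_simp
      _ ≤ M / a ^ 4 * (r ^ α * (M * V)) := by gcongr
      _ = M * M / a ^ 4 * r ^ α * V := by ring
      _ ≤ _ := by
        gcongr
        have : 0 < (a ^ α)⁻¹ := by positivity
        linarith
end
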